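/- Let 1 < p < q < ∞ and let s be a real number with 1/q < s < 1/p. There exists a constant C (depending only on p, q, s and φ₀) such that for every finite nonempty set E of Haar indices and every Schwartz function f : ℝ → ℂ, one has ‖P_E f‖_{F^s_{p,q}} ≤ C · (#HF(E))^{s−1/q} · ‖f‖_{F^s_{p,q}}. -/

import Mathlib

open MeasureTheory Real FourierTransform
open scoped ENNReal

noncomputable section

def haarFn (j : ℕ) (μ : ℤ) : ℝ → ℂ := fun x =>
  (Set.Ico ((2:ℝ)^(-(j:ℤ)) * μ) ((2:ℝ)^(-(j:ℤ)) * (μ + 1/2))).indicator (fun _ => (1:ℂ)) x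
  - (Set.Ico ((2:ℝ)^(-(j:ℤ)) * (μ + 1/2)) ((2:ℝ)^(-(j:ℤ)) * (μ + 1))).indicator (fun _ => (1:ℂ)) x

def haarProj (E : Finset (ℕ × ℤ)) (f : ℝ → ℂ) : ℝ → ℂ := fun x =>
  ∑ e ∈ E, (2:ℂ)^e.1 * (∫ y : ℝ, f y * haarFn e.1 e.2 y) * haarFn e.1 e.2 x

def HFset (E : Finset (ℕ × ℤ)) : Finset ℕ := E.image Prod.fst

def conv (f g : ℝ → ℂ) : ℝ → ℂ := fun x => ∫ t : ℝ, f t * g (x - t)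

def LPop (φ₀ : ℝ → ℂ) (k : ℕ) (g : ℝ → ℂ) : ℝ → ℂ :=
  if k = 0 then conv g (𝓕⁻ φ₀)
  else conv g (fun x => (2:ℂ)^k * (𝓕⁻ (fun ξ => φ₀ ξ - φ₀ (2*ξ))) ((2:ℝ)^k * x))

def FNorm (φ₀ : ℝ → ℂ) (p q s : ℝ) (g : ℝ → ℂ) : ℝ≥0∞ :=
  (∫⁻ x : ℝ, (∑' k : ℕ, ENNReal.ofReal ((2:ℝ)^((k:ℝ)*s*q)) *
      (ENNReal.ofReal ‖LPop φ₀ k g x‖)^q)^(p/q) ∂volume)^(1/p)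

theorem ENNReal.iSup_rpow_of_pos {ι : Type*} (f : ι → ℝ≥0∞) {p : ℝ} (hp : 0 < p) :
    (⨆ i, f i) ^ p = ⨆ i, f i ^ p :=
  (ENNReal.orderIsoRpow p hp).map_iSup f

theorem lintegral_Lp_tsum_le {α ι : Type*} [MeasurableSpace α] {μ : Measure α} [Countable ι]
    {p : ℝ} (hp : 1 ≤ p) {f : ι → α → ℝ≥0∞} (hf : ∀ i, Measurable (f i)) :
    (∫⁻ x, (∑' i, f i x) ^ p ∂μ) ^ (1 / p) ≤ ∑' i, (∫⁻ x, f i x ^ p ∂μ) ^ (1 / p) := by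
  have hp0 : 0 < p := by linarith
  have hfin : ∀ s : Finset ι,
      (∫⁻ x, (∑ i ∈ s, f i x) ^ p ∂μ) ^ (1 / p) ≤ ∑ i ∈ s, (∫⁻ x, f i x ^ p ∂μ) ^ (1 / p) := by
    classical
    intro s
    induction s using Finset.induction_on with
    | empty => simp [ENNReal.zero_rpow_of_pos hp0, ENNReal.zero_rpow_of_pos (inv_pos.2 hp0)]
    | insert a s ha ih =>
      simp only [Finset.sum_insert ha]
      refine (ENNReal.lintegral_Lp_add_le (hf a).aemeasurable
        (Finset.measurable_fun_sum s fun i _ => hf i).aemeasurable hp).trans ?_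
      gcongr
  have h1 : (∫⁻ x, (∑' i, f i x) ^ p ∂μ) = ⨆ s : Finset ι, ∫⁻ x, (∑ i ∈ s, f i x) ^ p ∂μ := by
    rw [← lintegral_iSup_directed]
    · refine lintegral_congr fun x => ?_
      rw [ENNReal.tsum_eq_iSup_sum, ENNReal.iSup_rpow_of_pos _ hp0]
    · exact fun s => ((Finset.measurable_fun_sum s fun i _ => hf i).pow_const p).aemeasurable
    · refine Monotone.directed_le fun s t hst x => ?_
      exact ENNReal.rpow_le_rpow (Finset.sum_le_sum_of_subset hst) hp0.le
  rw [h1, ENNReal.iSup_rpow_of_pos _ (by positivity)]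
  exact iSup_le fun s => (hfin s).trans (ENNReal.sum_le_tsum s)

/-- The norm of a sequence of nonnegative functions in `L^p(ℓ^q)`. -/
def mixedNorm (p q : ℝ) (g : ℤ → ℝ → ℝ≥0∞) : ℝ≥0∞ :=
  (∫⁻ x, (∑' k, g k x ^ q) ^ (p / q)) ^ (1 / p)

section MixedNorm

variable {p q : ℝ}

theorem mixedNorm_mono_ae (hp : 0 < p) (hq : 0 < q) {g h : ℤ → ℝ → ℝ≥0∞}
    (hgh : ∀ᵐ x, ∀ k, g k x ≤ h k x) : mixedNorm p q g ≤ mixedNorm p q h := by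
  unfold mixedNorm
  gcongr ?_ ^ _
  refine lintegral_mono_ae (hgh.mono fun x hx => ?_)
  have := fun k => hx k
  gcongr with k
  exact hx k

theorem mixedNorm_mono (hp : 0 < p) (hq : 0 < q) {g h : ℤ → ℝ → ℝ≥0∞}
    (hgh : ∀ k x, g k x ≤ h k x) : mixedNorm p q g ≤ mixedNorm p q h :=
  mixedNorm_mono_ae hp hq (.of_forall fun x k => hgh k x)

theorem mixedNorm_const_mul (hp : 0 < p) (hq : 0 < q) {g : ℤ → ℝ → ℝ≥0∞}
    (hg : ∀ k, Measurable (g k)) (c : ℝ≥0∞) :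
    mixedNorm p q (fun k x => c * g k x) = c * mixedNorm p q g := by
  unfold mixedNorm
  have h1 : ∀ x, (∑' k, (c * g k x) ^ q) ^ (p / q) = c ^ p * (∑' k, g k x ^ q) ^ (p / q) := by
    intro x
    simp only [ENNReal.mul_rpow_of_nonneg _ _ hq.le, ENNReal.tsum_mul_left]
    rw [ENNReal.mul_rpow_of_nonneg _ _ (by positivity), ← ENNReal.rpow_mul]
    congr 2
    field_simp
  simp only [h1]
  rw [lintegral_const_mul _ ((Measurable.tsum fun k => (hg k).pow_const q).pow_const _),
    ENNReal.mul_rpow_of_nonneg _ _ (by positivity), ← ENNReal.rpow_mul]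
  rw [mul_one_div_cancel hp.ne', ENNReal.rpow_one]

theorem mixedNorm_shift (g : ℤ → ℝ → ℝ≥0∞) (m : ℤ) :
    mixedNorm p q (fun k => g (k + m)) = mixedNorm p q g := by
  unfold mixedNorm
  congr 1
  refine lintegral_congr fun x => ?_
  congr 1
  exact (Equiv.addRight m).tsum_eq fun k => g k x ^ q

theorem mixedNorm_tsum_le {ι : Type*} [Countable ι] (hp : 1 ≤ p) (hq : 1 ≤ q)
    {g : ι → ℤ → ℝ → ℝ≥0∞} (hg : ∀ i k, Measurable (g i k)) :
    mixedNorm p q (fun k x => ∑' i, g i k x) ≤ ∑' i, mixedNorm p q (g i) := by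
  have hq0 : 0 < q := by linarith
  have hp0 : 0 < p := by linarith
  unfold mixedNorm
  have key : ∀ y : ℝ≥0∞, y ^ (p / q) = (y ^ (1 / q)) ^ p := fun y => by
    rw [← ENNReal.rpow_mul]; congr 1; ring
  simp only [key]
  refine le_trans ?_ (lintegral_Lp_tsum_le hp fun i =>
    (Measurable.tsum fun k => (hg i k).pow_const q).pow_const (1 / q))
  gcongr with x
  have := lintegral_Lp_tsum_le (μ := Measure.count) hq (f := fun i (k : ℤ) => g i k x)
    (fun i => measurable_of_countable _)
  simpa only [lintegral_count] using this

/-- Resummation along diagonals: a triple-indexed family is estimated by its diagonals. -/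
theorem mixedNorm_diagonal_le (hp : 1 ≤ p) (hq : 1 ≤ q)
    {a : ℤ → ℤ → ℤ → ℝ → ℝ≥0∞} (ha : ∀ j k l, Measurable (a j k l)) :
    mixedNorm p q (fun k x => ∑' j, ∑' l, a j k l x) ≤
      ∑' m, ∑' n, mixedNorm p q (fun j => a j (j + m) (j + n)) := by
  have h1 : (fun k x => ∑' j, ∑' l, a j k l x) =
      fun k x => ∑' m, ∑' n, a (k - m) k (k - m + n) x := by
    ext k x
    rw [← (Equiv.subLeft k).tsum_eq]
    refine tsum_congr fun m => ?_
    rw [← (Equiv.addLeft (k - m)).tsum_eq]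
    rfl
  rw [h1]
  refine (mixedNorm_tsum_le hp hq fun m k => Measurable.tsum fun n => ha _ _ _).trans ?_
  refine ENNReal.tsum_le_tsum fun m => ?_
  refine (mixedNorm_tsum_le hp hq fun n k => ha _ _ _).trans ?_
  refine ENNReal.tsum_le_tsum fun n => ?_
  rw [← mixedNorm_shift _ m]
  simp

end MixedNorm

/-- Weak type estimate for the Hardy–Littlewood maximal function on the line. -/
theorem volume_exists_closedBall_le (h : ℝ → ℝ≥0∞) {c : ℝ} (hc : 0 < c) :
    ENNReal.ofReal c * volume {x : ℝ | ∃ R > 0, ENNReal.ofReal (c * R) <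
      ∫⁻ y in Metric.closedBall x R, h y} ≤ 8 * ∫⁻ y, h y := by
  by_cases hI : ∫⁻ y, h y = ∞
  · simp [hI]
  set S := {x : ℝ | ∃ R > 0, ENNReal.ofReal (c * R) < ∫⁻ y in Metric.closedBall x R, h y}
  have hR : ∀ x : S, ∃ R > 0, ENNReal.ofReal (c * R) <
    ∫⁻ y in Metric.closedBall (x : ℝ) R, h y := fun x => x.2
  choose R hR0 hR using hR
  have hbd : ∀ x ∈ (Set.univ : Set S), R x ≤ (∫⁻ y, h y).toReal / c := by
    intro x _
    rw [le_div_iff₀ hc, mul_comm]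
    refine (ENNReal.ofReal_le_iff_le_toReal hI).1 ?_
    exact (hR x).le.trans (setLIntegral_le_lintegral _ _)
  obtain ⟨u, -, hdisj, hcov⟩ := Vitali.exists_disjoint_subfamily_covering_enlargement_closedBall
    (Set.univ : Set S) (fun x => (x : ℝ)) R _ hbd 4 (by norm_num)
  have hucount : u.Countable := by
    refine hdisj.countable_of_nonempty_interior fun x _ => ?_
    rw [interior_closedBall _ (hR0 x).ne']
    exact ⟨x, Metric.mem_ball_self (hR0 x)⟩
  have hsub : S ⊆ ⋃ x ∈ u, Metric.closedBall (x : ℝ) (4 * R x) := by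
    intro x hx
    obtain ⟨b, hb, hxb⟩ := hcov ⟨x, hx⟩ trivial
    exact Set.mem_biUnion hb (hxb (Metric.mem_closedBall_self (hR0 ⟨x, hx⟩).le))
  have : Countable u := hucount.to_subtype
  calc ENNReal.ofReal c * volume S
      ≤ ENNReal.ofReal c * ∑' x : u, volume (Metric.closedBall (x : ℝ) (4 * R x)) := by
        gcongr
        exact (measure_mono hsub).trans (measure_biUnion_le _ hucount _)
    _ = ∑' x : u, 8 * ENNReal.ofReal (c * R x) := by
        rw [← ENNReal.tsum_mul_left]
        refine tsum_congr fun x => ?_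
        rw [Real.volume_closedBall, ← ENNReal.ofReal_mul hc.le,
          show (8 : ℝ≥0∞) = ENNReal.ofReal 8 by simp, ← ENNReal.ofReal_mul (by norm_num)]
        congr 1; ring
    _ ≤ ∑' x : u, 8 * ∫⁻ y in Metric.closedBall (x : ℝ) (R x), h y := by
        gcongr with x
        exact (hR x).le
    _ = 8 * ∫⁻ y in ⋃ x ∈ u, Metric.closedBall (x : ℝ) (R x), h y := by
        rw [ENNReal.tsum_mul_left, lintegral_biUnion hucount
          (fun x _ => Metric.isClosed_closedBall.measurableSet) hdisj]
    _ ≤ 8 * ∫⁻ y, h y := mul_le_mul_right (setLIntegral_le_lintegral _ _) _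

/-- The index of the dyadic interval of length `2^{-j}` that contains `x`. -/
def dyadicIdx (j : ℤ) (x : ℝ) : ℤ := ⌊(2 : ℝ) ^ j * x⌋

theorem measurable_dyadicIdx (j : ℤ) : Measurable (dyadicIdx j) :=
  Int.measurable_floor.comp (measurable_const_mul _)

/-- The weight used for the averaging operators. -/
def cubicWeight (i : ℤ) : ℝ := ((1 + |(i : ℝ)|) ^ 3)⁻¹

theorem cubicWeight_pos (i : ℤ) : 0 < cubicWeight i := by unfold cubicWeight; positivity

theorem cubicWeight_neg (i : ℤ) : cubicWeight (-i) = cubicWeight i := by simp [cubicWeight]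

theorem cubicWeight_zero : cubicWeight 0 = 1 := by simp [cubicWeight]

theorem summable_weight_mul : Summable fun i : ℤ => (1 + |(i : ℝ)|) * cubicWeight i := by
  have h1 : Summable fun i : ℤ => (|(i : ℝ)| ^ (2 : ℝ))⁻¹ := by
    have := Real.summable_abs_int_rpow (b := 2) (by norm_num)
    refine this.congr fun i => ?_
    rw [Real.rpow_neg (abs_nonneg _)]
  refine Summable.of_norm_bounded_eventually h1 ?_
  filter_upwards [(Set.finite_singleton (0 : ℤ)).compl_mem_cofinite] with i hi
  have hi0 : 0 < |(i : ℝ)| := by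
    have : i ≠ 0 := by simpa using hi
    positivity
  have hc := cubicWeight_pos i
  rw [Real.norm_of_nonneg (by positivity)]
  unfold cubicWeight
  have e : (1 + |(i : ℝ)|) * ((1 + |(i : ℝ)|) ^ 3)⁻¹ = ((1 + |(i : ℝ)|) ^ 2)⁻¹ := by
    field_simp
  rw [e, Real.rpow_two]
  exact inv_anti₀ (by positivity) (by gcongr; linarith)

/-- The averaging operator at scale `2^{-j}`. -/
def avgOp (j : ℤ) (g : ℝ → ℝ≥0∞) (x : ℝ) : ℝ≥0∞ :=
  ∫⁻ y, ENNReal.ofReal ((2 : ℝ) ^ j * cubicWeight (dyadicIdx j x - dyadicIdx j y)) * g y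

theorem measurable_avgKernel (j : ℤ) : Measurable fun z : ℝ × ℝ =>
    ENNReal.ofReal ((2 : ℝ) ^ j * cubicWeight (dyadicIdx j z.1 - dyadicIdx j z.2)) := by
  refine ENNReal.measurable_ofReal.comp (Measurable.const_mul ?_ _)
  exact (measurable_of_countable cubicWeight).comp
    (((measurable_dyadicIdx j).comp measurable_fst).sub
      ((measurable_dyadicIdx j).comp measurable_snd))

theorem measurable_avgOp (j : ℤ) {g : ℝ → ℝ≥0∞} (hg : Measurable g) : Measurable (avgOp j g) :=
  Measurable.lintegral_prod_right' (f := fun z : ℝ × ℝ => _ * g z.2)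
    ((measurable_avgKernel j).mul (hg.comp measurable_snd))

theorem avgOp_mono (j : ℤ) {g h : ℝ → ℝ≥0∞} (hgh : ∀ x, g x ≤ h x) (x : ℝ) :
    avgOp j g x ≤ avgOp j h x := by
  unfold avgOp
  gcongr with y
  exact hgh y

theorem avgOp_const_mul (j : ℤ) {g : ℝ → ℝ≥0∞} (hg : Measurable g) (c : ℝ≥0∞) (x : ℝ) :
    avgOp j (fun y => c * g y) x = c * avgOp j g x := by
  unfold avgOp
  rw [← lintegral_const_mul]
  · refine lintegral_congr fun y => ?_
    ring
  · exact ((measurable_avgKernel j).comp measurable_prodMk_left).mul hg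

theorem avgOp_congr_idx (j : ℤ) (g : ℝ → ℝ≥0∞) {x y : ℝ} (hxy : dyadicIdx j x = dyadicIdx j y) :
    avgOp j g x = avgOp j g y := by
  unfold avgOp; rw [hxy]

theorem lintegral_eq_tsum_dyadic (j : ℤ) (g : ℝ → ℝ≥0∞) :
    ∫⁻ y, g y = ∑' ν : ℤ, ∫⁻ y in dyadicIdx j ⁻¹' {ν}, g y := by
  rw [← lintegral_iUnion (fun ν => measurable_dyadicIdx j (measurableSet_singleton ν))]
  · rw [← Set.preimage_iUnion, Set.iUnion_of_singleton, Set.preimage_univ, setLIntegral_univ]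
  · exact fun a b hab => Disjoint.preimage _ (by simpa using hab)

theorem dyadic_fiber_eq (j ν : ℤ) :
    dyadicIdx j ⁻¹' {ν} = Set.Ico ((2 : ℝ) ^ (-j) * ν) ((2 : ℝ) ^ (-j) * (ν + 1)) := by
  ext x
  have h2 : (0 : ℝ) < 2 ^ j := by positivity
  simp only [dyadicIdx, Set.mem_preimage, Set.mem_singleton_iff, Int.floor_eq_iff, Set.mem_Ico,
    zpow_neg]
  rw [inv_mul_le_iff₀ h2, lt_inv_mul_iff₀ h2]

theorem volume_dyadic_fiber (j ν : ℤ) :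
    volume (dyadicIdx j ⁻¹' {ν}) = ENNReal.ofReal ((2 : ℝ) ^ (-j)) := by
  rw [dyadic_fiber_eq, Real.volume_Ico]
  congr 1; ring

theorem avgOp_eq_tsum (j : ℤ) {g : ℝ → ℝ≥0∞} (hg : Measurable g) (x : ℝ) :
    avgOp j g x = ∑' ν : ℤ, ENNReal.ofReal (cubicWeight (dyadicIdx j x - ν)) *
      (ENNReal.ofReal ((2 : ℝ) ^ j) * ∫⁻ y in dyadicIdx j ⁻¹' {ν}, g y) := by
  unfold avgOp
  rw [lintegral_eq_tsum_dyadic j]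
  refine tsum_congr fun ν => ?_
  rw [← mul_assoc, ← lintegral_const_mul _ hg]
  refine setLIntegral_congr_fun (measurable_dyadicIdx j (measurableSet_singleton ν)) fun y hy => ?_
  have : dyadicIdx j y = ν := hy
  simp only [this]
  rw [mul_comm ((2 : ℝ) ^ j), ENNReal.ofReal_mul (cubicWeight_pos _).le]

/-- The constant that controls the averaging operators. -/
def weightSum : ℝ := ∑' i : ℤ, (1 + |(i : ℝ)|) * cubicWeight i

theorem one_le_weightSum : 1 ≤ weightSum := by
  have := summable_weight_mul.le_tsum (0 : ℤ)
    (fun i _ => mul_nonneg (by positivity) (cubicWeight_pos i).le)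
  simpa [cubicWeight_zero, weightSum] using this

theorem tsum_weight_mul (c : ℤ) : ∑' ν : ℤ, ENNReal.ofReal ((1 + |((c - ν : ℤ) : ℝ)|) *
    cubicWeight (c - ν)) = ENNReal.ofReal weightSum := by
  rw [weightSum, ENNReal.ofReal_tsum_of_nonneg
    (fun i => mul_nonneg (by positivity) (cubicWeight_pos i).le) summable_weight_mul]
  exact (Equiv.subLeft c).tsum_eq fun i : ℤ => ENNReal.ofReal ((1 + |(i : ℝ)|) * cubicWeight i)

theorem tsum_weight_le (c : ℤ) : ∑' ν : ℤ, ENNReal.ofReal (cubicWeight (c - ν)) ≤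
    ENNReal.ofReal weightSum := by
  rw [← tsum_weight_mul c]
  refine ENNReal.tsum_le_tsum fun ν => ENNReal.ofReal_le_ofReal ?_
  have := cubicWeight_pos (c - ν)
  have h2 := abs_nonneg (((c - ν : ℤ) : ℝ))
  nlinarith

theorem lintegral_avgKernel_le (j : ℤ) (x : ℝ) :
    ∫⁻ y, ENNReal.ofReal ((2 : ℝ) ^ j * cubicWeight (dyadicIdx j x - dyadicIdx j y)) ≤
      ENNReal.ofReal weightSum := by
  have := avgOp_eq_tsum j (g := fun _ => 1) measurable_const x
  simp only [avgOp, mul_one, lintegral_const, Measure.restrict_apply MeasurableSet.univ,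
    Set.univ_inter, one_mul, volume_dyadic_fiber] at this
  rw [this]
  refine le_trans (le_of_eq ?_) (tsum_weight_le (dyadicIdx j x))
  refine tsum_congr fun ν => ?_
  rw [← ENNReal.ofReal_mul (by positivity), ← zpow_add₀ (by norm_num)]
  simp

theorem lintegral_avgOp_le (j : ℤ) {g : ℝ → ℝ≥0∞} (hg : Measurable g) :
    ∫⁻ x, avgOp j g x ≤ ENNReal.ofReal weightSum * ∫⁻ y, g y := by
  unfold avgOp
  rw [lintegral_lintegral_swap
    ((measurable_avgKernel j).mul (hg.comp measurable_snd)).aemeasurable,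
    ← lintegral_const_mul _ hg]
  refine lintegral_mono fun y => ?_
  rw [lintegral_mul_const]
  · gcongr
    refine le_trans (le_of_eq (lintegral_congr fun x => ?_)) (lintegral_avgKernel_le j y)
    rw [← cubicWeight_neg, neg_sub]
  · exact Measurable.of_uncurry_right (f := fun x y => ENNReal.ofReal ((2 : ℝ) ^ j *
      cubicWeight (dyadicIdx j x - dyadicIdx j y))) (measurable_avgKernel j)

/-- If the averages of `h` over all balls about `x` are at most `c`, so are the operators
`avgOp j`, up to a constant. -/
theorem avgOp_le_of_forall_closedBall (j : ℤ) {h : ℝ → ℝ≥0∞} (hh : Measurable h) {x c : ℝ}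
    (hc : 0 ≤ c)
    (hx : ∀ R > 0, ∫⁻ y in Metric.closedBall x R, h y ≤ ENNReal.ofReal (c * R)) :
    avgOp j h x ≤ ENNReal.ofReal (weightSum * c) := by
  rw [avgOp_eq_tsum j hh, mul_comm weightSum, ENNReal.ofReal_mul hc,
    ← tsum_weight_mul (dyadicIdx j x), ← ENNReal.tsum_mul_left]
  refine ENNReal.tsum_le_tsum fun ν => ?_
  set d := |((dyadicIdx j x - ν : ℤ) : ℝ)| with hd
  have hd0 : 0 ≤ d := abs_nonneg _
  have h2 : (0 : ℝ) < 2 ^ j := by positivity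
  have hsub : dyadicIdx j ⁻¹' {ν} ⊆ Metric.closedBall x ((1 + d) * 2 ^ (-j)) := by
    intro y hy
    have hy : ⌊(2 : ℝ) ^ j * y⌋ = ν := hy
    have hmul : |(2 : ℝ) ^ j * (y - x)| = |y - x| * 2 ^ j := by
      rw [abs_mul, abs_of_pos h2, mul_comm]
    rw [Metric.mem_closedBall, Real.dist_eq, zpow_neg, ← div_eq_mul_inv, le_div_iff₀ h2,
      ← hmul]
    have e1 := Int.floor_le ((2 : ℝ) ^ j * y)
    have e2 := Int.lt_floor_add_one ((2 : ℝ) ^ j * y)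
    have e3 := Int.floor_le ((2 : ℝ) ^ j * x)
    have e4 := Int.lt_floor_add_one ((2 : ℝ) ^ j * x)
    rw [hy] at e1 e2
    have e5 := le_abs_self ((dyadicIdx j x - ν : ℤ) : ℝ)
    have e6 := neg_abs_le ((dyadicIdx j x - ν : ℤ) : ℝ)
    rw [← hd] at e5 e6
    unfold dyadicIdx at e5 e6
    push_cast at e5 e6
    rw [abs_le]
    constructor <;> nlinarith
  have h3 := (lintegral_mono_set hsub).trans (hx ((1 + d) * 2 ^ (-j)) (by positivity))
  calc _ ≤ ENNReal.ofReal (cubicWeight (dyadicIdx j x - ν)) *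
        (ENNReal.ofReal ((2 : ℝ) ^ j) * ENNReal.ofReal (c * ((1 + d) * 2 ^ (-j)))) := by gcongr
    _ = _ := by
      rw [← ENNReal.ofReal_mul h2.le, ← ENNReal.ofReal_mul (cubicWeight_pos _).le,
        ← ENNReal.ofReal_mul hc]
      congr 1
      rw [zpow_neg]; field_simp

/-- The two-sided geometric series with ratio `2^{-γ}`. -/
def geomSum (γ : ℝ) : ℝ := ∑' i : ℤ, (2 : ℝ) ^ (-γ * |(i : ℝ)|)

theorem summable_geomSum {γ : ℝ} (hγ : 0 < γ) :
    Summable fun i : ℤ => (2 : ℝ) ^ (-γ * |(i : ℝ)|) := by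
  have h1 : Summable fun n : ℕ => (2 : ℝ) ^ (-γ * |((n : ℤ) : ℝ)|) := by
    have := summable_geometric_of_lt_one (r := (2 : ℝ) ^ (-γ)) (by positivity)
      (Real.rpow_lt_one_of_one_lt_of_neg (by norm_num) (by linarith))
    refine this.congr fun n => ?_
    rw [← Real.rpow_natCast, ← Real.rpow_mul (by norm_num)]
    simp
  refine Summable.of_nat_of_neg h1 ?_
  simpa using h1

theorem geomSum_pos {γ : ℝ} (hγ : 0 < γ) : 0 < geomSum γ :=
  (summable_geomSum hγ).tsum_pos (fun i => by positivity) 0 (by positivity)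

theorem tsum_geom_shift {γ : ℝ} (hγ : 0 < γ) (c : ℤ) :
    ∑' i : ℤ, ENNReal.ofReal ((2 : ℝ) ^ (-γ * |((i - c : ℤ) : ℝ)|)) =
      ENNReal.ofReal (geomSum γ) := by
  rw [geomSum, ENNReal.ofReal_tsum_of_nonneg (fun i => by positivity) (summable_geomSum hγ)]
  exact (Equiv.subRight c).tsum_eq fun i : ℤ => ENNReal.ofReal ((2 : ℝ) ^ (-γ * |(i : ℝ)|))

theorem rpow_le_tsum_dyadic {r : ℝ} (hr : 0 < r) (a : ℝ≥0∞) :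
    a ^ r ≤ ∑' i : ℤ, if ENNReal.ofReal ((2 : ℝ) ^ i) < a then
      ENNReal.ofReal (((2 : ℝ) ^ (i + 1)) ^ r) else 0 := by
  rcases eq_or_ne a 0 with rfl | h0
  · simp [ENNReal.zero_rpow_of_pos hr]
  rcases eq_or_ne a ∞ with rfl | ht
  · simp only [ENNReal.ofReal_lt_top, if_true]
    refine le_trans ?_ (ENNReal.tsum_comp_le_tsum_of_injective
      (Nat.cast_injective (R := ℤ)) (fun i : ℤ => ENNReal.ofReal (((2 : ℝ) ^ (i + 1)) ^ r)))
    have : ∑' _ : ℕ, (1 : ℝ≥0∞) ≤ ∑' n : ℕ, ENNReal.ofReal (((2 : ℝ) ^ ((n : ℤ) + 1)) ^ r) := by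
      refine ENNReal.tsum_le_tsum fun n => ?_
      rw [← ENNReal.ofReal_one]
      refine ENNReal.ofReal_le_ofReal (Real.one_le_rpow ?_ hr.le)
      exact one_le_zpow₀ (by norm_num) (by positivity)
    rw [ENNReal.tsum_const_eq_top_of_ne_zero one_ne_zero] at this
    exact le_top.trans this
  lift a to NNReal using ht
  have h0' : (0 : ℝ) < a := by
    have : a ≠ 0 := by simpa using h0
    positivity
  obtain ⟨c, hc1, hc2⟩ := exists_mem_Ioc_zpow h0' (one_lt_two)
  refine le_trans ?_ (ENNReal.le_tsum c)
  rw [if_pos]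
  · rw [← ENNReal.ofReal_coe_nnreal, ENNReal.ofReal_rpow_of_nonneg (by positivity) hr.le]
    exact ENNReal.ofReal_le_ofReal (Real.rpow_le_rpow (by positivity) hc2 hr.le)
  · rw [← ENNReal.ofReal_coe_nnreal]
    exact (ENNReal.ofReal_lt_ofReal_iff h0').2 hc1

theorem tsum_dyadic_le_rpow {r : ℝ} (hr : 0 < r) (a : ℝ≥0∞) :
    (∑' i : ℤ, if ENNReal.ofReal ((2 : ℝ) ^ i) < a then
      ENNReal.ofReal (((2 : ℝ) ^ i) ^ r) else 0) ≤ ENNReal.ofReal (geomSum r) * a ^ r := by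
  rcases eq_or_ne a 0 with rfl | h0
  · simp
  rcases eq_or_ne a ∞ with rfl | ht
  · rw [ENNReal.top_rpow_of_pos hr, ENNReal.mul_top]
    · exact le_top
    · simpa using geomSum_pos hr
  lift a to NNReal using ht
  have h0' : (0 : ℝ) < a := by
    have : a ≠ 0 := by simpa using h0
    positivity
  obtain ⟨c, hc1, hc2⟩ := exists_mem_Ioc_zpow h0' (one_lt_two)
  rw [← tsum_geom_shift hr c, ← ENNReal.tsum_mul_right]
  refine ENNReal.tsum_le_tsum fun i => ?_
  split_ifs with hi
  · rw [← ENNReal.ofReal_coe_nnreal] at hi ⊢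
    rw [ENNReal.ofReal_lt_ofReal_iff h0'] at hi
    have hic : i ≤ c := by
      have := (zpow_lt_zpow_iff_right₀ (one_lt_two (α := ℝ))).1 (hi.trans_le hc2)
      omega
    rw [ENNReal.ofReal_rpow_of_nonneg (by positivity) hr.le, ← ENNReal.ofReal_mul (by positivity)]
    refine ENNReal.ofReal_le_ofReal ?_
    have e : ((2 : ℝ) ^ i) ^ r = 2 ^ (-r * |((i - c : ℤ) : ℝ)|) * ((2 : ℝ) ^ c) ^ r := by
      have hic' : ((i - c : ℤ) : ℝ) ≤ 0 := by exact_mod_cast (by omega : i - c ≤ 0)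
      rw [abs_of_nonpos hic', ← Real.rpow_intCast, ← Real.rpow_intCast, ← Real.rpow_mul (by norm_num),
        ← Real.rpow_mul (by norm_num), ← Real.rpow_add (by norm_num)]
      congr 1
      push_cast; ring
    rw [e]
    gcongr
  · exact zero_le

theorem mul_rpow_sub_one {r : ℝ} (hr : 1 < r) (a : ℝ≥0∞) : a * a ^ (r - 1) = a ^ r := by
  nth_rw 1 [← ENNReal.rpow_one a]
  rw [← ENNReal.rpow_add_of_nonneg _ _ (by norm_num) (by linarith)]
  congr 1; ring

/-- The maximal function associated with the averaging operators. -/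
def avgMax (h : ℝ → ℝ≥0∞) (x : ℝ) : ℝ≥0∞ := ⨆ j, avgOp j h x

theorem measurable_avgMax {h : ℝ → ℝ≥0∞} (hh : Measurable h) : Measurable (avgMax h) :=
  Measurable.iSup fun j => measurable_avgOp j hh

theorem volume_avgMax_le {h : ℝ → ℝ≥0∞} (hh : Measurable h) {t : ℝ} (ht : 0 < t) :
    ENNReal.ofReal t * volume {x | ENNReal.ofReal (2 * weightSum * t) < avgMax h x} ≤
      8 * ∫⁻ y, if ENNReal.ofReal t < h y then h y else 0 := by
  have hS := one_le_weightSum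
  set h' : ℝ → ℝ≥0∞ := fun y => if ENNReal.ofReal t < h y then h y else 0 with hh'
  have hm' : Measurable h' :=
    Measurable.ite (measurableSet_lt measurable_const hh) hh measurable_const
  refine le_trans ?_ (volume_exists_closedBall_le h' ht)
  refine mul_le_mul_right (measure_mono fun x hx => ?_) _
  obtain ⟨j, hj⟩ := lt_iSup_iff.1 (show _ < ⨆ j, avgOp j h x from hx)
  by_contra hcon
  simp only [Set.mem_ofPred_eq, not_exists, not_and, not_lt, gt_iff_lt] at hcon
  have h1 := avgOp_le_of_forall_closedBall j hm' ht.le hcon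
  have h2 : avgOp j h x ≤ avgOp j h' x + ENNReal.ofReal weightSum * ENNReal.ofReal t := by
    calc avgOp j h x ≤ avgOp j (fun y => h' y + ENNReal.ofReal t) x := by
          refine avgOp_mono j (fun y => ?_) x
          simp only [hh']
          split_ifs with hy
          · exact le_self_add
          · simpa using hy
      _ = avgOp j h' x + ∫⁻ y, ENNReal.ofReal ((2 : ℝ) ^ j *
            cubicWeight (dyadicIdx j x - dyadicIdx j y)) * ENNReal.ofReal t := by
          unfold avgOp
          simp only [mul_add]
          rw [lintegral_add_left]
          exact ((measurable_avgKernel j).comp measurable_prodMk_left).mul hm'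
      _ ≤ _ := by
          rw [lintegral_mul_const' _ _ ENNReal.ofReal_ne_top]
          gcongr
          exact lintegral_avgKernel_le j x
  rw [← ENNReal.ofReal_mul (by linarith)] at h2
  refine absurd (h2.trans (add_le_add_left h1 _)) (not_le.2 ?_)
  rw [← ENNReal.ofReal_add (by positivity) (by positivity)]
  convert hj using 2
  ring

theorem lintegral_avgMax_rpow_le {r : ℝ} (hr : 1 < r) :
    ∃ C : NNReal, ∀ h : ℝ → ℝ≥0∞, Measurable h →
      ∫⁻ x, avgMax h x ^ r ≤ C * ∫⁻ x, h x ^ r := by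
  have hS := one_le_weightSum
  have hS0 : 0 < 2 * weightSum := by linarith
  have hr0 : 0 < r := by linarith
  refine ⟨(ENNReal.ofReal ((2 * weightSum) ^ r) * (ENNReal.ofReal (2 ^ r) *
    (8 * ENNReal.ofReal (geomSum (r - 1))))).toNNReal, fun h hh => ?_⟩
  rw [ENNReal.coe_toNNReal (by finiteness)]
  have hscale : ∀ x, avgMax h x ^ r = ENNReal.ofReal ((2 * weightSum) ^ r) *
      (avgMax h x / ENNReal.ofReal (2 * weightSum)) ^ r := by
    intro x
    rw [← ENNReal.ofReal_rpow_of_pos hS0, ← ENNReal.mul_rpow_of_nonneg _ _ hr0.le,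
      ENNReal.mul_div_cancel (by simpa using hS0) ENNReal.ofReal_ne_top]
  have hlt : ∀ (i : ℤ) x, ENNReal.ofReal ((2 : ℝ) ^ i) < avgMax h x / ENNReal.ofReal (2 * weightSum)
      ↔ ENNReal.ofReal (2 * weightSum * 2 ^ i) < avgMax h x := by
    intro i x
    rw [ENNReal.lt_div_iff_mul_lt (.inl (by simpa using hS0)) (.inl ENNReal.ofReal_ne_top),
      ← ENNReal.ofReal_mul (by positivity),
      mul_comm]
  have hset : ∀ i : ℤ, MeasurableSet
      {x | ENNReal.ofReal (2 * weightSum * 2 ^ i) < avgMax h x} := fun i =>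
    measurableSet_lt measurable_const (measurable_avgMax hh)
  simp only [hscale]
  rw [lintegral_const_mul _ (((measurable_avgMax hh).div_const _).pow_const _), mul_assoc]
  gcongr
  calc ∫⁻ x, (avgMax h x / ENNReal.ofReal (2 * weightSum)) ^ r
      ≤ ∫⁻ x, ∑' i : ℤ, {x | ENNReal.ofReal (2 * weightSum * 2 ^ i) < avgMax h x}.indicator
          (fun _ => ENNReal.ofReal (((2 : ℝ) ^ (i + 1)) ^ r)) x := by
        refine lintegral_mono fun x => (rpow_le_tsum_dyadic hr0 _).trans (le_of_eq ?_)
        refine tsum_congr fun i => ?_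
        simp only [hlt, Set.indicator_apply, Set.mem_ofPred_eq]
    _ = ∑' i : ℤ, ENNReal.ofReal (((2 : ℝ) ^ (i + 1)) ^ r) *
          volume {x | ENNReal.ofReal (2 * weightSum * 2 ^ i) < avgMax h x} := by
        rw [lintegral_tsum fun i => (measurable_const.indicator (hset i)).aemeasurable]
        refine tsum_congr fun i => ?_
        rw [lintegral_indicator_const (hset i)]
    _ ≤ ∑' i : ℤ, ENNReal.ofReal (2 ^ r) * (8 * ∫⁻ y, if ENNReal.ofReal ((2 : ℝ) ^ i) < h y then
          ENNReal.ofReal (((2 : ℝ) ^ i) ^ (r - 1)) * h y else 0) := by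
        refine ENNReal.tsum_le_tsum fun i => ?_
        have h2 : (0 : ℝ) < 2 ^ i := by positivity
        have e : ((2 : ℝ) ^ (i + 1)) ^ r = 2 ^ r * (((2 : ℝ) ^ i) ^ (r - 1) * 2 ^ i) := by
          rw [Real.rpow_sub_one h2.ne', zpow_add_one₀ (by norm_num), Real.mul_rpow h2.le (by norm_num)]
          field_simp
        rw [e, ENNReal.ofReal_mul (by positivity), ENNReal.ofReal_mul (by positivity), mul_assoc,
          mul_assoc]
        refine mul_le_mul_right ?_ _
        refine (mul_le_mul_right (volume_avgMax_le hh h2) _).trans (le_of_eq ?_)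
        rw [mul_left_comm, ← lintegral_const_mul _
          (Measurable.ite (measurableSet_lt measurable_const hh) hh measurable_const)]
        simp only [mul_ite, mul_zero]
    _ = ENNReal.ofReal (2 ^ r) * (8 * ∫⁻ y, h y * ∑' i : ℤ, if ENNReal.ofReal ((2 : ℝ) ^ i) < h y
          then ENNReal.ofReal (((2 : ℝ) ^ i) ^ (r - 1)) else 0) := by
        rw [ENNReal.tsum_mul_left, ENNReal.tsum_mul_left, ← lintegral_tsum fun i => Measurable.aemeasurable
          (Measurable.ite (measurableSet_lt measurable_const hh) (hh.const_mul _) measurable_const)]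
        simp only [← ENNReal.tsum_mul_left, mul_ite, mul_zero, mul_comm]
    _ ≤ ENNReal.ofReal (2 ^ r) * (8 * ∫⁻ y, ENNReal.ofReal (geomSum (r - 1)) * h y ^ r) := by
        refine mul_le_mul_right (mul_le_mul_right (lintegral_mono fun y => ?_) _) _
        refine (mul_le_mul_right (tsum_dyadic_le_rpow (by linarith) _) _).trans ?_
        rw [mul_left_comm, mul_rpow_sub_one hr]
    _ = _ := by
        rw [lintegral_const_mul _ (hh.pow_const _)]
        ring

theorem avgOp_congr_ae (j : ℤ) {g h : ℝ → ℝ≥0∞} (hgh : g =ᵐ[volume] h) (x : ℝ) :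
    avgOp j g x = avgOp j h x := by
  unfold avgOp
  exact lintegral_congr_ae (hgh.mono fun y hy => by simp only [hy])

theorem avgOp_mul_le (j : ℤ) {q q' : ℝ} (hq : q.HolderConjugate q') {u v : ℝ → ℝ≥0∞}
    (hu : Measurable u) (hv : Measurable v) (x : ℝ) :
    avgOp j (fun y => u y * v y) x ≤
      avgOp j (fun y => u y ^ q) x ^ (1 / q) * avgOp j (fun y => v y ^ q') x ^ (1 / q') := by
  have hk : Measurable fun y => ENNReal.ofReal
      ((2 : ℝ) ^ j * cubicWeight (dyadicIdx j x - dyadicIdx j y)) :=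
    Measurable.of_uncurry_left (f := fun x y => ENNReal.ofReal
      ((2 : ℝ) ^ j * cubicWeight (dyadicIdx j x - dyadicIdx j y))) (measurable_avgKernel j)
  have hq0 := hq.pos
  have hq0' := hq.symm.pos
  unfold avgOp
  set b : ℝ → ℝ≥0∞ := fun y => ENNReal.ofReal
      ((2 : ℝ) ^ j * cubicWeight (dyadicIdx j x - dyadicIdx j y)) with hb
  change ∫⁻ y, b y * (u y * v y) ≤ (∫⁻ y, b y * u y ^ q) ^ (1 / q) *
    (∫⁻ y, b y * v y ^ q') ^ (1 / q')
  have := ENNReal.lintegral_mul_le_Lp_mul_Lq volume hq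
    (f := fun y => b y ^ (1 / q) * u y) (g := fun y => b y ^ (1 / q') * v y)
    ((hk.pow_const _).mul hu).aemeasurable ((hk.pow_const _).mul hv).aemeasurable
  simp only [ENNReal.mul_rpow_of_nonneg _ _ hq0.le, ENNReal.mul_rpow_of_nonneg _ _ hq0'.le,
    ← ENNReal.rpow_mul, one_div_mul_cancel hq0.ne', one_div_mul_cancel hq0'.ne',
    ENNReal.rpow_one] at this
  refine le_trans (le_of_eq (lintegral_congr fun y => ?_)) this
  simp only [Pi.mul_apply]
  have e : b y = b y ^ (1 / q) * b y ^ (1 / q') := by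
    rw [← ENNReal.rpow_add_of_nonneg _ _ (by positivity) (by positivity)]
    simp [hq.inv_add_inv_eq_one]
  nth_rw 1 [e]
  ring

/-- Vector valued estimate for averaging operators. -/
theorem lintegral_tsum_avgOp_le {p q : ℝ} (hp : 1 < p) (hpq : p < q) :
    ∃ C : NNReal, ∀ (σ : ℤ → ℤ) (g : ℤ → ℝ → ℝ≥0∞), (∀ k, Measurable (g k)) →
      ∫⁻ x, (∑' k, avgOp (σ k) (g k) x ^ q) ^ (p / q) ≤
        C * ∫⁻ x, (∑' k, g k x ^ q) ^ (p / q) := by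
  have hp0 : 0 < p := by linarith
  have hq0 : 0 < q := by linarith
  have hq1 : 0 < q - 1 := by linarith
  have hqp : 0 < q - p := by linarith
  set α : ℝ := (q - p) / q ^ 2 with hα
  set q' : ℝ := q / (q - 1) with hq'
  set r : ℝ := (q - 1) * p / (q - p) with hr
  have hα0 : 0 < α := by positivity
  have hq'0 : 0 < q' := by positivity
  have hr1 : 1 < r := by
    rw [hr, one_lt_div hqp]; nlinarith
  have hconj : q.HolderConjugate q' := Real.HolderConjugate.conjExponent (by linarith)
  obtain ⟨C, hC⟩ := lintegral_avgMax_rpow_le hr1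
  refine ⟨(ENNReal.ofReal weightSum ^ (p / q) * (C : ℝ≥0∞) ^ ((q - p) / q)).toNNReal + 1,
    fun σ g hg => ?_⟩
  have hfinC : ENNReal.ofReal weightSum ^ (p / q) * (C : ℝ≥0∞) ^ ((q - p) / q) ≠ ∞ :=
    ENNReal.mul_ne_top (ENNReal.rpow_ne_top_of_nonneg (by positivity) ENNReal.ofReal_ne_top)
      (ENNReal.rpow_ne_top_of_nonneg (by positivity) ENNReal.coe_ne_top)
  rw [ENNReal.coe_add, ENNReal.coe_toNNReal hfinC]
  set Y : ℝ → ℝ≥0∞ := fun x => ∑' k, g k x ^ q with hY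
  have hYm : Measurable Y := Measurable.tsum fun k => (hg k).pow_const q
  by_cases hI : ∫⁻ x, Y x ^ (p / q) = ∞
  · change _ ≤ _ * ∫⁻ x, Y x ^ (p / q)
    rw [hI, ENNReal.mul_top (by simp)]
    exact le_top
  have hYfin : ∀ᵐ x, Y x < ∞ := by
    refine (ae_lt_top (hYm.pow_const _) hI).mono fun x hx => ?_
    exact (ENNReal.rpow_lt_top_iff_of_pos (by positivity)).1 hx
  set u : ℤ → ℝ → ℝ≥0∞ := fun k x => g k x * Y x ^ (-α) with hu
  have hum : ∀ k, Measurable (u k) := fun k => (hg k).mul (hYm.pow_const _)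
  have hguv : ∀ k, g k =ᵐ[volume] fun x => u k x * Y x ^ α := by
    intro k
    filter_upwards [hYfin] with x hx
    simp only [hu]
    rcases eq_or_ne (Y x) 0 with h0 | h0
    · have : g k x = 0 := by
        have := (ENNReal.tsum_eq_zero.1 (show ∑' k, g k x ^ q = 0 from h0)) k
        simpa [ENNReal.rpow_eq_zero_iff, hq0, hq0.not_gt] using this
      simp [this]
    · rw [mul_assoc, ← ENNReal.rpow_add _ _ h0 hx.ne]
      simp
  set W : ℝ → ℝ≥0∞ := avgMax fun x => Y x ^ (α * q') with hW
  have hWm : Measurable W := measurable_avgMax (hYm.pow_const _)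
  have hpt : ∀ x k, avgOp (σ k) (g k) x ^ q ≤
      avgOp (σ k) (fun y => u k y ^ q) x * W x ^ (q - 1) := by
    intro x k
    rw [avgOp_congr_ae _ (hguv k)]
    have h1 := avgOp_mul_le (σ k) hconj (hum k) (hYm.pow_const α) x
    have h2 := ENNReal.rpow_le_rpow h1 hq0.le
    rw [ENNReal.mul_rpow_of_nonneg _ _ hq0.le, ← ENNReal.rpow_mul, one_div_mul_cancel hq0.ne',
      ENNReal.rpow_one, ← ENNReal.rpow_mul] at h2
    have e : 1 / q' * q = q - 1 := by rw [hq']; field_simp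
    rw [e] at h2
    refine h2.trans (mul_le_mul_right (ENNReal.rpow_le_rpow ?_ hq1.le) _)
    simp only [← ENNReal.rpow_mul]
    exact le_iSup (fun j => avgOp j (fun x => Y x ^ (α * q')) x) (σ k)
  have hsum : ∫⁻ x, ∑' k, avgOp (σ k) (fun y => u k y ^ q) x ≤
      ENNReal.ofReal weightSum * ∫⁻ x, Y x ^ (p / q) := by
    rw [lintegral_tsum fun k => (measurable_avgOp _ ((hum k).pow_const q)).aemeasurable]
    calc _ ≤ ∑' k, ENNReal.ofReal weightSum * ∫⁻ x, u k x ^ q :=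
          ENNReal.tsum_le_tsum fun k => lintegral_avgOp_le _ ((hum k).pow_const q)
      _ = ENNReal.ofReal weightSum * ∫⁻ x, ∑' k, u k x ^ q := by
          rw [ENNReal.tsum_mul_left, lintegral_tsum fun k => ((hum k).pow_const q).aemeasurable]
      _ ≤ _ := by
          refine mul_le_mul_right (lintegral_mono fun x => ?_) _
          simp only [hu, ENNReal.mul_rpow_of_nonneg _ _ hq0.le, ENNReal.tsum_mul_right]
          change Y x * _ ≤ _
          rcases eq_or_ne (Y x) 0 with h0 | h0
          · simp [h0]
          rcases eq_or_ne (Y x) ∞ with ht | ht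
          · simp [ht, ENNReal.top_rpow_of_pos, hp0, hq0]
          refine le_of_eq ?_
          nth_rw 1 [← ENNReal.rpow_one (Y x)]
          rw [← ENNReal.rpow_mul, ← ENNReal.rpow_add _ _ h0 ht]
          congr 1
          rw [hα]; field_simp; ring
  have hWint : ∫⁻ x, W x ^ r ≤ C * ∫⁻ x, Y x ^ (p / q) := by
    refine (hC _ (hYm.pow_const _)).trans (le_of_eq ?_)
    simp only [← ENNReal.rpow_mul]
    have e : α * q' * r = p / q := by rw [hα, hq', hr]; field_simp
    rw [e]
  have hconj2 : (q / p).HolderConjugate (q / (q - p)) := by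
    rw [Real.holderConjugate_iff]
    refine ⟨by rw [one_lt_div hp0]; exact hpq, ?_⟩
    field_simp; ring
  calc ∫⁻ x, (∑' k, avgOp (σ k) (g k) x ^ q) ^ (p / q)
      ≤ ∫⁻ x, (∑' k, avgOp (σ k) (fun y => u k y ^ q) x) ^ (p / q) *
          W x ^ ((q - 1) * (p / q)) := by
        refine lintegral_mono fun x => ?_
        rw [ENNReal.rpow_mul, ← ENNReal.mul_rpow_of_nonneg _ _ (by positivity),
          ← ENNReal.tsum_mul_right]
        exact ENNReal.rpow_le_rpow (ENNReal.tsum_le_tsum (hpt x)) (by positivity)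
    _ ≤ (∫⁻ x, ∑' k, avgOp (σ k) (fun y => u k y ^ q) x) ^ (p / q) *
          (∫⁻ x, W x ^ r) ^ ((q - p) / q) := by
        have := ENNReal.lintegral_mul_le_Lp_mul_Lq volume hconj2
          (f := fun x => (∑' k, avgOp (σ k) (fun y => u k y ^ q) x) ^ (p / q))
          (g := fun x => W x ^ ((q - 1) * (p / q)))
          ((Measurable.tsum fun k => measurable_avgOp _
            ((hum k).pow_const q)).pow_const _).aemeasurable (hWm.pow_const _).aemeasurable
        simp only [← ENNReal.rpow_mul] at this
        have e1 : p / q * (q / p) = 1 := by field_simp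
        have e2 : (q - 1) * (p / q) * (q / (q - p)) = r := by rw [hr]; field_simp
        rw [e1, e2, one_div_div, one_div_div] at this
        simpa only [ENNReal.rpow_one, Pi.mul_apply] using this
    _ ≤ (ENNReal.ofReal weightSum * ∫⁻ x, Y x ^ (p / q)) ^ (p / q) *
          (C * ∫⁻ x, Y x ^ (p / q)) ^ ((q - p) / q) :=
        mul_le_mul' (ENNReal.rpow_le_rpow hsum (by positivity))
          (ENNReal.rpow_le_rpow hWint (by positivity))
    _ = ENNReal.ofReal weightSum ^ (p / q) * (C : ℝ≥0∞) ^ ((q - p) / q) *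
          ∫⁻ x, Y x ^ (p / q) := by
        rw [ENNReal.mul_rpow_of_nonneg _ _ (by positivity),
          ENNReal.mul_rpow_of_nonneg _ _ (by positivity), mul_mul_mul_comm,
          ← ENNReal.rpow_add_of_nonneg _ _ (by positivity) (by positivity)]
        have e : p / q + (q - p) / q = 1 := by field_simp; ring
        rw [e, ENNReal.rpow_one]
    _ ≤ _ := mul_le_mul_left le_self_add _

theorem mixedNorm_avgOp_le {p q : ℝ} (hp : 1 < p) (hpq : p < q) :
    ∃ C : NNReal, ∀ (σ : ℤ → ℤ) (g : ℤ → ℝ → ℝ≥0∞), (∀ k, Measurable (g k)) →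
      mixedNorm p q (fun k => avgOp (σ k) (g k)) ≤ C * mixedNorm p q g := by
  obtain ⟨C, hC⟩ := lintegral_tsum_avgOp_le hp hpq
  have hp0 : 0 < 1 / p := by positivity
  refine ⟨C ^ (1 / p), fun σ g hg => ?_⟩
  unfold mixedNorm
  rw [ENNReal.coe_rpow_of_nonneg _ hp0.le, ← ENNReal.mul_rpow_of_nonneg _ _ hp0.le]
  exact ENNReal.rpow_le_rpow (hC σ g hg) hp0.le

theorem dyadicIdx_eq_div (i : ℤ) (n : ℕ) (x : ℝ) :
    dyadicIdx i x = dyadicIdx (i + n) x / ((2 ^ n : ℕ) : ℤ) := by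
  unfold dyadicIdx
  rw [← Int.floor_div_natCast]
  congr 1
  rw [zpow_add₀ (by norm_num)]
  push_cast
  rw [zpow_natCast]
  field_simp

/-- Points sharing a dyadic interval share all larger dyadic intervals. -/
theorem dyadicIdx_eq_of_le {i i' : ℤ} (hi : i ≤ i') {x y : ℝ}
    (h : dyadicIdx i' x = dyadicIdx i' y) : dyadicIdx i x = dyadicIdx i y := by
  obtain ⟨n, rfl⟩ := Int.le.dest hi
  rw [dyadicIdx_eq_div i n, dyadicIdx_eq_div i n, h]

/-- Functions that are constant on dyadic intervals of length `2^(-i)`. -/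
def IsDyadicStep {β : Type*} (i : ℤ) (f : ℝ → β) : Prop :=
  ∀ x y, dyadicIdx i x = dyadicIdx i y → f x = f y

theorem dyadicIdx_left_endpoint (i ν : ℤ) : dyadicIdx i ((2 : ℝ) ^ (-i) * ν) = ν := by
  unfold dyadicIdx
  rw [← mul_assoc, ← zpow_add₀ (by norm_num)]
  simp

theorem IsDyadicStep.eq_comp {β : Type*} {i : ℤ} {f : ℝ → β} (hf : IsDyadicStep i f) (x : ℝ) :
    f x = f ((2 : ℝ) ^ (-i) * dyadicIdx i x) :=
  hf _ _ (dyadicIdx_left_endpoint i _).symm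

theorem IsDyadicStep.measurable {β : Type*} [MeasurableSpace β] {i : ℤ} {f : ℝ → β}
    (hf : IsDyadicStep i f) : Measurable f := by
  have : f = (fun ν : ℤ => f ((2 : ℝ) ^ (-i) * ν)) ∘ dyadicIdx i := funext hf.eq_comp
  rw [this]
  exact (measurable_of_countable _).comp (measurable_dyadicIdx i)

theorem IsDyadicStep.mono {β : Type*} {i i' : ℤ} (hi : i ≤ i') {f : ℝ → β}
    (hf : IsDyadicStep i f) : IsDyadicStep i' f :=
  fun x y h => hf x y (dyadicIdx_eq_of_le hi h)

theorem lintegral_mul_step_le {i : ℤ} {f u : ℝ → ℝ≥0∞} (hf : IsDyadicStep i f)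
    (hu : Measurable u) {c : ℝ≥0∞}
    (huc : ∀ ν, ∫⁻ x in dyadicIdx i ⁻¹' {ν}, u x ≤ c * ENNReal.ofReal ((2 : ℝ) ^ (-i))) :
    ∫⁻ x, u x * f x ≤ c * ∫⁻ x, f x := by
  rw [lintegral_eq_tsum_dyadic i, lintegral_eq_tsum_dyadic i f, ← ENNReal.tsum_mul_left]
  refine ENNReal.tsum_le_tsum fun ν => ?_
  have hm : MeasurableSet (dyadicIdx i ⁻¹' {ν}) := measurable_dyadicIdx i (measurableSet_singleton ν)
  have h1 : ∀ x ∈ dyadicIdx i ⁻¹' {ν}, f x = f ((2 : ℝ) ^ (-i) * ν) := by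
    intro x hx
    rw [hf.eq_comp x]
    simp only [Set.mem_preimage, Set.mem_singleton_iff] at hx
    rw [hx]
  rw [setLIntegral_congr_fun hm (g := fun x => u x * f ((2 : ℝ) ^ (-i) * ν))
      (fun x hx => by simp only [h1 x hx]),
    setLIntegral_congr_fun hm (g := fun _ => f ((2 : ℝ) ^ (-i) * ν)) h1,
    lintegral_mul_const _ hu, lintegral_const, Measure.restrict_apply MeasurableSet.univ,
    Set.univ_inter, volume_dyadic_fiber]
  calc _ ≤ (c * ENNReal.ofReal ((2 : ℝ) ^ (-i))) * f ((2 : ℝ) ^ (-i) * ν) := by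
        gcongr; exact huc ν
    _ = _ := by ring

theorem mul_add_rpow_sub_one_le {r : ℝ} (hr0 : 0 < r) (hr1 : r < 1) (S a : ℝ≥0∞) :
    S ^ r + ENNReal.ofReal r * (a * (S + a) ^ (r - 1)) ≤ (S + a) ^ r := by
  rcases eq_or_ne (S + a) ∞ with h | h
  · rw [h, ENNReal.top_rpow_of_pos hr0]; exact le_top
  rcases eq_or_ne (S + a) 0 with h0 | h0
  · have : S = 0 ∧ a = 0 := by simpa using h0
    simp [this.1, this.2, hr0]
  have hS : S ≠ ∞ := fun e => h (by simp [e])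
  have ha : a ≠ ∞ := fun e => h (by simp [e])
  lift S to NNReal using hS
  lift a to NNReal using ha
  have hT : S + a ≠ 0 := by exact_mod_cast h0
  have hT0 : (0 : ℝ) < S + a := by
    have := pos_iff_ne_zero.2 hT; exact_mod_cast this
  rw [← ENNReal.coe_add, ← ENNReal.coe_rpow_of_nonneg _ hr0.le,
    ← ENNReal.coe_rpow_of_nonneg _ hr0.le, ← ENNReal.coe_rpow_of_ne_zero hT,
    ENNReal.ofReal, ← ENNReal.coe_mul, ← ENNReal.coe_mul, ← ENNReal.coe_add, ENNReal.coe_le_coe,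
    ← NNReal.coe_le_coe]
  push_cast
  rw [Real.coe_toNNReal _ hr0.le]
  have hb := rpow_one_add_le_one_add_mul_self (s := -(a : ℝ) / (S + a))
    (by rw [le_div_iff₀ hT0]; linarith [S.coe_nonneg]) hr0.le hr1.le
  have e1 : 1 + -(a : ℝ) / (S + a) = S / (S + a) := by field_simp; ring
  rw [e1, Real.div_rpow S.coe_nonneg hT0.le, div_le_iff₀ (by positivity)] at hb
  rw [Real.rpow_sub_one hT0.ne']
  calc _ ≤ (1 + r * (-(a : ℝ) / (S + a))) * ((S : ℝ) + a) ^ r +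
      r * (a * (((S : ℝ) + a) ^ r / (S + a))) := by gcongr
    _ = _ := by field_simp; ring

theorem sum_mul_partialSum_rpow_le {r : ℝ} (hr0 : 0 < r) (hr1 : r < 1) (B : Finset ℤ)
    (a : ℤ → ℝ≥0∞) :
    ENNReal.ofReal r * ∑ j ∈ B, a j * (∑ i ∈ B with i ≤ j, a i) ^ (r - 1) ≤
      (∑ j ∈ B, a j) ^ r := by
  induction B using Finset.induction_on_max with
  | empty => simp
  | insert m B hm ih =>
    have hmB : m ∉ B := fun h => lt_irrefl _ (hm m h)
    have e1 : ∀ j ∈ B, (insert m B).filter (· ≤ j) = B.filter (· ≤ j) := by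
      intro j hj
      rw [Finset.filter_insert, if_neg (not_le.2 (hm j hj))]
    have e2 : (insert m B).filter (· ≤ m) = insert m B := by
      refine Finset.filter_true_of_mem fun i hi => ?_
      rcases Finset.mem_insert.1 hi with rfl | h
      · exact le_rfl
      · exact (hm i h).le
    rw [Finset.sum_insert hmB, e2, Finset.sum_insert hmB, mul_add]
    have e3 : ∑ j ∈ B, a j * (∑ i ∈ insert m B with i ≤ j, a i) ^ (r - 1) =
        ∑ j ∈ B, a j * (∑ i ∈ B with i ≤ j, a i) ^ (r - 1) :=
      Finset.sum_congr rfl fun j hj => by rw [e1 j hj]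
    rw [e3, add_comm]
    calc _ ≤ (∑ j ∈ B, a j) ^ r + ENNReal.ofReal r * (a m * (a m + ∑ i ∈ B, a i) ^ (r - 1)) := by
          gcongr
      _ ≤ _ := by
          rw [add_comm (a m)]
          exact mul_add_rpow_sub_one_le hr0 hr1 _ _

/-- A Lenglart type inequality for sums of dyadic step functions damped by weights of small
conditional mean. -/
theorem lintegral_sum_step_rpow_le {r : ℝ} (hr0 : 0 < r) (hr1 : r < 1) (B : Finset ℤ)
    {a u : ℤ → ℝ → ℝ≥0∞} (ha : ∀ j, IsDyadicStep (j + 1) (a j)) (hu : ∀ j, Measurable (u j)) {c : ℝ≥0∞}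
    (hc0 : c ≠ 0) (hc : c ≠ ∞)
    (huc : ∀ j ν, ∫⁻ x in dyadicIdx (j + 1) ⁻¹' {ν}, u j x ≤
      c * ENNReal.ofReal ((2 : ℝ) ^ (-(j + 1)))) :
    ∫⁻ x, (∑ j ∈ B, u j x * a j x) ^ r ≤
      (c / ENNReal.ofReal r) ^ r * ∫⁻ x, (∑ j ∈ B, a j x) ^ r := by
  set S : ℝ → ℝ≥0∞ := fun x => ∑ j ∈ B, a j x with hS
  have ham : ∀ j, Measurable (a j) := fun j => (ha j).measurable
  have hSm : Measurable S := Finset.measurable_sum _ fun j _ => ham j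
  by_cases hI : ∫⁻ x, S x ^ r = ∞
  · rw [hI, ENNReal.mul_top]
    · exact le_top
    · exact (ENNReal.rpow_pos (ENNReal.div_pos hc0 ENNReal.ofReal_ne_top)
        (ENNReal.div_ne_top hc (by simpa using hr0))).ne'
  have hfin : ∀ᵐ x, S x < ∞ := by
    filter_upwards [ae_lt_top (hSm.pow_const r) hI] with x hx
    rwa [ENNReal.rpow_lt_top_iff_of_pos hr0] at hx
  set P : ℤ → ℝ → ℝ≥0∞ := fun j x => (∑ i ∈ B with i ≤ j, a i x) ^ (r - 1) with hP
  have hPstep : ∀ j, IsDyadicStep (j + 1) (fun x => a j x * P j x) := by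
    intro j x y hxy
    simp only [hP]
    rw [ha j x y hxy, Finset.sum_congr rfl fun i hi =>
      ((ha i).mono (i' := j + 1) (by have := (Finset.mem_filter.1 hi).2; lia)) x y hxy]
  set Y : ℝ → ℝ≥0∞ := fun x => ∑ j ∈ B, u j x * (a j x * P j x) with hY
  have hYm : Measurable Y := Finset.measurable_sum _ fun j _ => (hu j).mul (hPstep j).measurable
  have h1 : ∀ᵐ x, (∑ j ∈ B, u j x * a j x) ^ r ≤ Y x ^ r * (S x ^ r) ^ (1 - r) := by
    filter_upwards [hfin] with x hx
    rw [← ENNReal.rpow_mul, mul_comm r (1 - r), ENNReal.rpow_mul,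
      ← ENNReal.mul_rpow_of_nonneg _ _ hr0.le]
    gcongr
    rw [hY, Finset.sum_mul]
    refine Finset.sum_le_sum fun j hj => ?_
    rw [mul_assoc, mul_assoc]
    gcongr
    rcases eq_or_ne (a j x) 0 with h0 | h0
    · simp [h0]
    set T := ∑ i ∈ B with i ≤ j, a i x with hT
    have hTS : T ≤ S x := Finset.sum_le_sum_of_subset (Finset.filter_subset _ _)
    have hT0 : T ≠ 0 := by
      intro h
      rw [hT, Finset.sum_eq_zero_iff] at h
      exact h0 (h j (by simp [hj]))
    have hTt : T ≠ ∞ := (hTS.trans_lt hx).ne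
    calc a j x = a j x * (T ^ (r - 1) * T ^ (1 - r)) := by
          rw [← ENNReal.rpow_add _ _ hT0 hTt]; simp
      _ ≤ a j x * (T ^ (r - 1) * S x ^ (1 - r)) := by gcongr
  have h2 : ∫⁻ x, Y x ≤ c / ENNReal.ofReal r * ∫⁻ x, S x ^ r := by
    calc ∫⁻ x, Y x = ∑ j ∈ B, ∫⁻ x, u j x * (a j x * P j x) :=
          lintegral_finsetSum _ fun j _ => (hu j).mul (hPstep j).measurable
      _ ≤ ∑ j ∈ B, c * ∫⁻ x, a j x * P j x :=
          Finset.sum_le_sum fun j _ => lintegral_mul_step_le (hPstep j) (hu j) (huc j)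
      _ = c * ∫⁻ x, ∑ j ∈ B, a j x * P j x := by
          rw [← Finset.mul_sum, lintegral_finsetSum _ fun j _ => (hPstep j).measurable]
      _ ≤ c * ((ENNReal.ofReal r)⁻¹ * ∫⁻ x, S x ^ r) := by
          gcongr
          rw [← lintegral_const_mul _ (hSm.pow_const r)]
          refine lintegral_mono fun x => ?_
          rw [mul_comm, ← div_eq_mul_inv, ENNReal.le_div_iff_mul_le (by simp [hr0]) (by simp), mul_comm]
          exact sum_mul_partialSum_rpow_le hr0 hr1 B fun j => a j x
      _ = _ := by rw [div_eq_mul_inv, mul_assoc]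
  calc ∫⁻ x, (∑ j ∈ B, u j x * a j x) ^ r ≤ ∫⁻ x, Y x ^ r * (S x ^ r) ^ (1 - r) :=
        lintegral_mono_ae h1
    _ ≤ (∫⁻ x, Y x) ^ r * (∫⁻ x, S x ^ r) ^ (1 - r) :=
        ENNReal.lintegral_mul_norm_pow_le hYm.aemeasurable (hSm.pow_const r).aemeasurable hr0.le
          (by linarith) (by ring)
    _ ≤ (c / ENNReal.ofReal r * ∫⁻ x, S x ^ r) ^ r * (∫⁻ x, S x ^ r) ^ (1 - r) := by gcongr
    _ = _ := by
        rw [ENNReal.mul_rpow_of_nonneg _ _ hr0.le, mul_assoc,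
          ← ENNReal.rpow_add_of_nonneg _ _ hr0.le (by linarith)]
        simp [hS]

theorem sum_rpow_le_card_mul {r : ℝ} (hr0 : 0 < r) (hr1 : r < 1) {ι : Type*} (B : Finset ι)
    (y : ι → ℝ≥0∞) :
    ∑ j ∈ B, y j ^ r ≤ (B.card : ℝ≥0∞) ^ (1 - r) * (∑ j ∈ B, y j) ^ r := by
  have h := ENNReal.rpow_sum_le_const_mul_sum_rpow B (fun j => y j ^ r)
    (p := 1 / r) (by rw [le_div_iff₀ hr0]; linarith)
  simp only [← ENNReal.rpow_mul, mul_one_div_cancel hr0.ne', ENNReal.rpow_one] at h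
  have h2 := ENNReal.rpow_le_rpow h hr0.le
  rw [← ENNReal.rpow_mul, one_div_mul_cancel hr0.ne', ENNReal.rpow_one,
    ENNReal.mul_rpow_of_nonneg _ _ hr0.le, ← ENNReal.rpow_mul] at h2
  rwa [show (1 / r - 1) * r = 1 - r by field_simp] at h2

theorem rpow_sum_le_sum_rpow {r : ℝ} (hr0 : 0 < r) (hr1 : r ≤ 1) {ι : Type*} (B : Finset ι)
    (y : ι → ℝ≥0∞) : (∑ j ∈ B, y j) ^ r ≤ ∑ j ∈ B, y j ^ r :=
  Finset.le_sum_of_subadditive (fun t : ℝ≥0∞ => t ^ r) (by simp [hr0])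
    (fun a b => ENNReal.rpow_add_le_add_rpow a b hr0.le hr1) B y

theorem ENNReal_rpow_le_self {u : ℝ≥0∞} (hu : u ≤ 1) {q : ℝ} (hq : 1 ≤ q) : u ^ q ≤ u := by
  simpa using ENNReal.rpow_le_rpow_of_exponent_ge hu hq

section Damped

variable {p q : ℝ} {B : Finset ℤ} {g u : ℤ → ℝ → ℝ≥0∞} {c : ℝ≥0∞}

theorem mixedNorm_damped_le (hp : 1 < p) (hpq : p < q)
    (hg : ∀ j, IsDyadicStep (j + 1) (g j)) (hgB : ∀ j ∉ B, ∀ x, g j x = 0)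
    (hu : ∀ j, Measurable (u j)) (hu1 : ∀ j x, u j x ≤ 1) (hc0 : c ≠ 0) (hc : c ≠ ∞)
    (huc : ∀ j ν, ∫⁻ x in dyadicIdx (j + 1) ⁻¹' {ν}, u j x ≤
      c * ENNReal.ofReal ((2 : ℝ) ^ (-(j + 1)))) :
    mixedNorm p q (fun j x => u j x * g j x) ≤
      (c / ENNReal.ofReal (p / q)) ^ (1 / q) * mixedNorm p q g := by
  have hp0 : 0 < p := by linarith
  have hq0 : 0 < q := by linarith
  have hr0 : 0 < p / q := by positivity
  have hr1 : p / q < 1 := by rwa [div_lt_one hq0]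
  unfold mixedNorm
  have e : (c / ENNReal.ofReal (p / q)) ^ (1 / q) =
      ((c / ENNReal.ofReal (p / q)) ^ (p / q)) ^ (1 / p) := by
    rw [← ENNReal.rpow_mul]; congr 1; field_simp
  rw [e, ← ENNReal.mul_rpow_of_nonneg _ _ (by positivity)]
  gcongr ?_ ^ _
  have h1 : ∀ x, ∑' j, g j x ^ q = ∑ j ∈ B, g j x ^ q := fun x =>
    tsum_eq_sum fun j hj => by simp [hgB j hj x, hq0]
  have h2 : ∀ x, ∑' j, (u j x * g j x) ^ q ≤ ∑ j ∈ B, u j x * g j x ^ q := fun x => by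
    rw [tsum_eq_sum (s := B) fun j hj => by simp [hgB j hj x, hq0]]
    refine Finset.sum_le_sum fun j _ => ?_
    rw [ENNReal.mul_rpow_of_nonneg _ _ hq0.le]
    gcongr
    exact ENNReal_rpow_le_self (hu1 j x) (by linarith)
  simp only [h1]
  refine (lintegral_mono fun x => ENNReal.rpow_le_rpow (h2 x) hr0.le).trans ?_
  exact lintegral_sum_step_rpow_le hr0 hr1 B (a := fun j x => g j x ^ q)
    (fun j x y h => by simp only [hg j x y h]) hu hc0 hc huc

theorem mixedNorm_damped_le_card (hp : 1 < p) (hpq : p < q)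
    (hg : ∀ j, IsDyadicStep (j + 1) (g j)) (hgB : ∀ j ∉ B, ∀ x, g j x = 0)
    (hu : ∀ j, Measurable (u j)) (hu1 : ∀ j x, u j x ≤ 1)
    (huc : ∀ j ν, ∫⁻ x in dyadicIdx (j + 1) ⁻¹' {ν}, u j x ≤
      c * ENNReal.ofReal ((2 : ℝ) ^ (-(j + 1)))) :
    mixedNorm p q (fun j x => u j x * g j x) ≤
      c ^ (1 / p) * (B.card : ℝ≥0∞) ^ (1 / p - 1 / q) * mixedNorm p q g := by
  have hp0 : 0 < p := by linarith
  have hq0 : 0 < q := by linarith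
  have hr0 : 0 < p / q := by positivity
  have hr1 : p / q < 1 := by rwa [div_lt_one hq0]
  unfold mixedNorm
  have e : (B.card : ℝ≥0∞) ^ (1 / p - 1 / q) = ((B.card : ℝ≥0∞) ^ (1 - p / q)) ^ (1 / p) := by
    rw [← ENNReal.rpow_mul]; congr 1; field_simp
  rw [e, ← ENNReal.mul_rpow_of_nonneg _ _ (by positivity),
    ← ENNReal.mul_rpow_of_nonneg _ _ (by positivity)]
  gcongr ?_ ^ _
  have hpow : ∀ t : ℝ≥0∞, (t ^ q) ^ (p / q) = t ^ p := fun t => by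
    rw [← ENNReal.rpow_mul]; congr 1; field_simp
  have hgs : ∀ j, IsDyadicStep (j + 1) fun x => g j x ^ p := fun j x y h => by
    simp only [hg j x y h]
  have h1 : ∀ x, ∑' j, g j x ^ q = ∑ j ∈ B, g j x ^ q := fun x =>
    tsum_eq_sum fun j hj => by simp [hgB j hj x, hq0]
  have h2 : ∀ x, (∑' j, (u j x * g j x) ^ q) ^ (p / q) ≤ ∑ j ∈ B, u j x * g j x ^ p := fun x => by
    rw [tsum_eq_sum (s := B) fun j hj => by simp [hgB j hj x, hq0]]
    refine (rpow_sum_le_sum_rpow hr0 hr1.le _ _).trans (Finset.sum_le_sum fun j _ => ?_)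
    rw [hpow, ENNReal.mul_rpow_of_nonneg _ _ hp0.le]
    gcongr
    exact ENNReal_rpow_le_self (hu1 j x) (by linarith)
  calc _ ≤ ∫⁻ x, ∑ j ∈ B, u j x * g j x ^ p := lintegral_mono h2
    _ = ∑ j ∈ B, ∫⁻ x, u j x * g j x ^ p :=
        lintegral_finsetSum _ fun j _ => (hu j).mul (hgs j).measurable
    _ ≤ ∑ j ∈ B, c * ∫⁻ x, g j x ^ p :=
        Finset.sum_le_sum fun j _ => lintegral_mul_step_le (hgs j) (hu j) (huc j)
    _ = c * ∫⁻ x, ∑ j ∈ B, g j x ^ p := by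
        rw [← Finset.mul_sum, lintegral_finsetSum _ fun j _ => (hgs j).measurable]
    _ ≤ c * ∫⁻ x, (B.card : ℝ≥0∞) ^ (1 - p / q) * (∑' j, g j x ^ q) ^ (p / q) := by
        gcongr with x
        rw [h1]
        simpa only [hpow] using sum_rpow_le_card_mul hr0 hr1 B fun j => g j x ^ q
    _ = _ := by
        rw [lintegral_const_mul' _ _
          (ENNReal.rpow_ne_top_of_nonneg (by linarith) (by simp)), mul_assoc]

end Damped

/-- A weight concentrated near the endpoints of the dyadic intervals of length `2^(-i)`. -/
def edgeWeight (k i : ℤ) (x : ℝ) : ℝ :=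
  ((1 + (2 : ℝ) ^ k * min (x - (2 : ℝ) ^ (-i) * dyadicIdx i x)
    ((2 : ℝ) ^ (-i) * (dyadicIdx i x + 1) - x)) ^ 2)⁻¹

theorem endpoint_le (i : ℤ) (x : ℝ) : 0 ≤ x - (2 : ℝ) ^ (-i) * dyadicIdx i x := by
  have h : x ∈ dyadicIdx i ⁻¹' {dyadicIdx i x} := rfl
  rw [dyadic_fiber_eq] at h
  linarith [h.1]

theorem le_endpoint (i : ℤ) (x : ℝ) : 0 ≤ (2 : ℝ) ^ (-i) * (dyadicIdx i x + 1) - x := by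
  have h : x ∈ dyadicIdx i ⁻¹' {dyadicIdx i x} := rfl
  rw [dyadic_fiber_eq] at h
  linarith [h.2]

theorem measurable_edgeWeight (k i : ℤ) : Measurable (edgeWeight k i) := by
  have h : Measurable fun x => ((dyadicIdx i x : ℤ) : ℝ) :=
    (measurable_of_countable (fun n : ℤ => (n : ℝ))).comp (measurable_dyadicIdx i)
  unfold edgeWeight
  fun_prop

theorem edgeWeight_le_one (k i : ℤ) (x : ℝ) : edgeWeight k i x ≤ 1 := by
  unfold edgeWeight
  refine inv_le_one_of_one_le₀ (one_le_pow₀ ?_)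
  have := le_min (endpoint_le i x) (le_endpoint i x)
  have h2 : (0 : ℝ) < 2 ^ k := by positivity
  nlinarith

/-- The total mass of the Japanese bracket to the power `-2`. -/
def bracketMass : ℝ≥0∞ := ∫⁻ y : ℝ, ENNReal.ofReal ((1 + |y|) ^ 2)⁻¹

theorem bracketMass_lt_top : bracketMass < ∞ := by
  have := finite_integral_one_add_norm (E := ℝ) (μ := volume) (r := 2) (by norm_num)
  refine lt_of_le_of_lt (le_of_eq (lintegral_congr fun y => ?_)) this
  rw [Real.rpow_neg (by positivity), Real.norm_eq_abs]
  norm_cast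

theorem lintegral_scaled_bracket (k : ℤ) (a : ℝ) :
    ∫⁻ x : ℝ, ENNReal.ofReal ((1 + |(2 : ℝ) ^ k * (x - a)|) ^ 2)⁻¹ =
      ENNReal.ofReal ((2 : ℝ) ^ (-k)) * bracketMass := by
  have h2 : (2 : ℝ) ^ k ≠ 0 := by positivity
  rw [lintegral_sub_right_eq_self (fun x => ENNReal.ofReal ((1 + |(2 : ℝ) ^ k * x|) ^ 2)⁻¹) a]
  have := lintegral_map (μ := volume) (f := fun y : ℝ => ENNReal.ofReal ((1 + |y|) ^ 2)⁻¹)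
    (g := fun x => (2 : ℝ) ^ k * x) (by fun_prop) (by fun_prop)
  rw [← this, Real.map_volume_mul_left h2, lintegral_smul_measure, bracketMass, smul_eq_mul,
    abs_of_pos (by positivity), zpow_neg]

theorem lintegral_edgeWeight_le (k i ν : ℤ) :
    ∫⁻ x in dyadicIdx i ⁻¹' {ν}, ENNReal.ofReal (edgeWeight k i x) ≤
      (2 * bracketMass * ENNReal.ofReal ((2 : ℝ) ^ (i - k))) * ENNReal.ofReal ((2 : ℝ) ^ (-i)) := by
  have hm : MeasurableSet (dyadicIdx i ⁻¹' {ν}) := measurable_dyadicIdx i (measurableSet_singleton ν)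
  have h1 : ∀ x ∈ dyadicIdx i ⁻¹' {ν}, ENNReal.ofReal (edgeWeight k i x) ≤
      ENNReal.ofReal ((1 + |(2 : ℝ) ^ k * (x - (2 : ℝ) ^ (-i) * ν)|) ^ 2)⁻¹ +
      ENNReal.ofReal ((1 + |(2 : ℝ) ^ k * (x - (2 : ℝ) ^ (-i) * (ν + 1))|) ^ 2)⁻¹ := by
    intro x hx
    have ha := endpoint_le i x
    have hb := le_endpoint i x
    have h2 : (0 : ℝ) < 2 ^ k := by positivity
    simp only [Set.mem_preimage, Set.mem_singleton_iff] at hx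
    unfold edgeWeight
    rw [hx] at ha hb ⊢
    rw [abs_of_nonneg (mul_nonneg h2.le ha), abs_of_nonpos (by nlinarith)]
    rcases min_cases (x - (2 : ℝ) ^ (-i) * ν) ((2 : ℝ) ^ (-i) * (ν + 1) - x) with h | h
    · rw [h.1]; exact le_self_add
    · rw [h.1]
      refine le_trans (le_of_eq ?_) le_add_self
      congr 4; ring
  calc _ ≤ ∫⁻ x in dyadicIdx i ⁻¹' {ν},
      (ENNReal.ofReal ((1 + |(2 : ℝ) ^ k * (x - (2 : ℝ) ^ (-i) * ν)|) ^ 2)⁻¹ +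
      ENNReal.ofReal ((1 + |(2 : ℝ) ^ k * (x - (2 : ℝ) ^ (-i) * (ν + 1))|) ^ 2)⁻¹) :=
        setLIntegral_mono' hm h1
    _ ≤ _ := setLIntegral_le_lintegral _ _
    _ = 2 * (ENNReal.ofReal ((2 : ℝ) ^ (-k)) * bracketMass) := by
        rw [lintegral_add_left (by fun_prop), lintegral_scaled_bracket, lintegral_scaled_bracket]
        ring
    _ = _ := by
        rw [mul_assoc, ← ENNReal.ofReal_mul (by positivity), ← zpow_add₀ (by norm_num),
          show i - k + -i = -k by ring]
        ring

/-- The `L¹`-normalised dilate of `Φ` at frequency `2^a`. -/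
def dil (Φ : ℝ → ℂ) (a : ℕ) (y : ℝ) : ℂ := (2 : ℂ) ^ a * Φ ((2 : ℝ) ^ a * y)

/-- The Littlewood-Paley kernels generated by `Φ`. -/
def lpKer (Φ : ℝ → ℂ) (k : ℕ) (y : ℝ) : ℂ :=
  if k = 0 then Φ y else dil Φ k y - dil Φ (k - 1) y

theorem fourierInv_comp_mul_left (φ : ℝ → ℂ) {a : ℝ} (ha : 0 < a) (x : ℝ) :
    𝓕⁻ (fun ξ => φ (a * ξ)) x = (a⁻¹ : ℝ) * 𝓕⁻ φ (a⁻¹ * x) := by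
  rw [Real.fourierInv_eq', Real.fourierInv_eq']
  have := MeasureTheory.Measure.integral_comp_mul_left
    (fun v => Complex.exp ((↑(2 * π * inner ℝ v (a⁻¹ * x)) * Complex.I)) • φ v) a
  rw [abs_of_pos (by positivity), Complex.real_smul] at this
  rw [← this]
  refine integral_congr_ae (.of_forall fun v => ?_)
  simp only [RCLike.inner_apply, conj_trivial]
  congr 5
  field_simp

section Kernels

variable {φ₀ : ℝ → ℂ} (hφsmooth : ContDiff ℝ (⊤ : ℕ∞) φ₀) (hφcpt : HasCompactSupport φ₀)

/-- The dilated bump as a Schwartz function. -/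
def scaledBump (a : ℕ) : SchwartzMap ℝ ℂ :=
  (hφcpt.comp_homeomorph (Homeomorph.mulLeft₀ (((2 : ℝ) ^ a)⁻¹) (by positivity))).toSchwartzMap
    (hφsmooth.comp (contDiff_const.mul contDiff_id))

theorem scaledBump_apply (a : ℕ) (ξ : ℝ) :
    scaledBump hφsmooth hφcpt a ξ = φ₀ (((2 : ℝ) ^ a)⁻¹ * ξ) := rfl

theorem fourierInv_scaledBump (a : ℕ) (y : ℝ) :
    (𝓕⁻ (scaledBump hφsmooth hφcpt a)) y = dil (𝓕⁻ φ₀) a y := by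
  rw [SchwartzMap.fourierInv_coe]
  have : ⇑(scaledBump hφsmooth hφcpt a) = fun ξ => φ₀ (((2 : ℝ) ^ a)⁻¹ * ξ) := rfl
  rw [this, fourierInv_comp_mul_left _ (by positivity)]
  simp [dil]

end Kernels

theorem exists_lpKernel {φ₀ : ℝ → ℂ} (hφsmooth : ContDiff ℝ (⊤ : ℕ∞) φ₀)
    (hφcpt : HasCompactSupport φ₀) (hφone : ∀ ξ : ℝ, |ξ| ≤ 4/3 → φ₀ ξ = 1)
    (hφzero : ∀ ξ : ℝ, 3/2 ≤ |ξ| → φ₀ ξ = 0) :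
    ∃ Φ : SchwartzMap ℝ ℂ, (∀ k g, LPop φ₀ k g = conv g (lpKer Φ k)) ∧ ∫ y, Φ y = 1 ∧
      ∀ a b, b < a → ∀ x, ∫ t, dil Φ b t * dil Φ a (x - t) = dil Φ b x := by
  set Φ : SchwartzMap ℝ ℂ := 𝓕⁻ (scaledBump hφsmooth hφcpt 0) with hΦ
  have hΦe : ⇑Φ = 𝓕⁻ φ₀ := by
    ext y; rw [hΦ, fourierInv_scaledBump]; simp [dil]
  refine ⟨Φ, fun k g => ?_, ?_, fun a b hab x => ?_⟩
  · rw [hΦe]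
    rcases k with _ | k
    · simp only [LPop, if_true]; rfl
    · simp only [LPop, Nat.add_eq_zero_iff, one_ne_zero, and_false, if_false]
      congr 1
      ext y
      simp only [lpKer, Nat.add_eq_zero_iff, one_ne_zero, and_false, if_false,
        Nat.add_sub_cancel, dil]
      have hi : Integrable φ₀ := hφsmooth.continuous.integrable_of_hasCompactSupport hφcpt
      have hi2 : Integrable fun ξ => φ₀ (2 * ξ) := hi.comp_mul_left' (by norm_num)
      have h1 : 𝓕⁻ (fun ξ => φ₀ ξ - φ₀ (2 * ξ)) ((2 : ℝ) ^ (k + 1) * y) =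
          𝓕⁻ φ₀ ((2 : ℝ) ^ (k + 1) * y) - 𝓕⁻ (fun ξ => φ₀ (2 * ξ)) ((2 : ℝ) ^ (k + 1) * y) := by
        simp only [Real.fourierInv_eq]
        rw [← integral_sub]
        · simp only [smul_sub]
        · simpa [real_inner_comm] using! (Real.fourierIntegral_convergent_iff (-((2 : ℝ) ^ (k + 1) * y))).2 hi
        · simpa [real_inner_comm] using! (Real.fourierIntegral_convergent_iff (-((2 : ℝ) ^ (k + 1) * y))).2 hi2
      rw [h1, fourierInv_comp_mul_left _ (by norm_num)]
      have h2 : (2 : ℝ)⁻¹ * (2 ^ (k + 1) * y) = 2 ^ k * y := by rw [pow_succ]; ring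
      rw [h2, pow_succ]
      push_cast
      ring
  · have h1 : 𝓕 Φ = scaledBump hφsmooth hφcpt 0 := by
      rw [hΦ, FourierTransform.fourier_fourierInv_eq]
    have h2 : (𝓕 Φ) 0 = 1 := by
      rw [h1, scaledBump_apply]; exact hφone _ (by norm_num)
    rw [SchwartzMap.fourier_coe, Real.fourier_eq] at h2
    simpa using h2
  · have h1 := SchwartzMap.convolution_apply (ContinuousLinearMap.mul ℂ ℂ)
      (𝓕⁻ (scaledBump hφsmooth hφcpt b)) (𝓕⁻ (scaledBump hφsmooth hφcpt a)) x
    have h2 : SchwartzMap.convolution (ContinuousLinearMap.mul ℂ ℂ)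
      (𝓕⁻ (scaledBump hφsmooth hφcpt b)) (𝓕⁻ (scaledBump hφsmooth hφcpt a)) =
        𝓕⁻ (scaledBump hφsmooth hφcpt b) := by
      have h3 := SchwartzMap.fourier_convolution (ContinuousLinearMap.mul ℂ ℂ)
        (𝓕⁻ (scaledBump hφsmooth hφcpt b)) (𝓕⁻ (scaledBump hφsmooth hφcpt a))
      rw [FourierTransform.fourier_fourierInv_eq, FourierTransform.fourier_fourierInv_eq] at h3
      have h4 : SchwartzMap.pairing (ContinuousLinearMap.mul ℂ ℂ) (scaledBump hφsmooth hφcpt b)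
          (scaledBump hφsmooth hφcpt a) = scaledBump hφsmooth hφcpt b := by
        ext ξ
        rw [SchwartzMap.pairing_apply_apply, scaledBump_apply, scaledBump_apply,
          ContinuousLinearMap.mul_apply']
        by_cases hξ : 3 / 2 ≤ |((2 : ℝ) ^ b)⁻¹ * ξ|
        · rw [hφzero _ hξ, zero_mul]
        · rw [hφone (((2 : ℝ) ^ a)⁻¹ * ξ), mul_one]
          push Not at hξ
          obtain ⟨n, rfl⟩ := Nat.exists_eq_add_of_lt hab
          rw [abs_mul, abs_of_pos (by positivity)] at hξ ⊢
          have : ((2 : ℝ) ^ (b + n + 1))⁻¹ ≤ 2⁻¹ * ((2 : ℝ) ^ b)⁻¹ := by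
            rw [← mul_inv, ← pow_succ']
            gcongr <;> norm_num
          nlinarith [abs_nonneg ξ]
      rw [h4] at h3
      simpa only [FourierTransform.fourierInv_fourier_eq] using
        congrArg (fun F : SchwartzMap ℝ ℂ => (𝓕⁻ F : SchwartzMap ℝ ℂ)) h3
    rw [h2] at h1
    simp only [MeasureTheory.convolution, ContinuousLinearMap.mul_apply',
      fourierInv_scaledBump] at h1
    rw [hΦe]
    exact h1.symm

theorem continuous_dil (Φ : SchwartzMap ℝ ℂ) (a : ℕ) : Continuous (dil Φ a) :=
  continuous_const.mul (Φ.continuous.comp (continuous_const.mul continuous_id))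

theorem continuous_lpKer (Φ : SchwartzMap ℝ ℂ) (k : ℕ) : Continuous (lpKer Φ k) := by
  unfold lpKer
  split_ifs
  · exact Φ.continuous
  · exact (continuous_dil Φ _).sub (continuous_dil Φ _)

theorem integrable_dil (Φ : SchwartzMap ℝ ℂ) (a : ℕ) : Integrable (dil Φ a) :=
  (Φ.integrable.comp_mul_left' (by positivity)).const_mul _

theorem integrable_lpKer (Φ : SchwartzMap ℝ ℂ) (k : ℕ) : Integrable (lpKer Φ k) := by
  unfold lpKer
  split_ifs
  · exact Φ.integrable
  · exact (integrable_dil Φ _).sub (integrable_dil Φ _)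

theorem integral_dil (Φ : SchwartzMap ℝ ℂ) (a : ℕ) : ∫ y, dil Φ a y = ∫ y, Φ y := by
  unfold dil
  rw [integral_const_mul, MeasureTheory.Measure.integral_comp_mul_left (fun y => Φ y),
    abs_of_pos (by positivity), Complex.real_smul, ← mul_assoc]
  push_cast
  rw [mul_inv_cancel₀ (pow_ne_zero _ two_ne_zero), one_mul]

theorem integral_lpKer (Φ : SchwartzMap ℝ ℂ) {k : ℕ} (hk : 1 ≤ k) : ∫ y, lpKer Φ k y = 0 := by
  have : k ≠ 0 := by lia
  simp only [lpKer, this, if_false]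
  rw [integral_sub (integrable_dil Φ _) (integrable_dil Φ _), integral_dil, integral_dil, sub_self]

theorem dil_zero (Φ : ℝ → ℂ) : dil Φ 0 = Φ := by ext y; simp [dil]

theorem sum_lpKer (Φ : ℝ → ℂ) (L : ℕ) (y : ℝ) :
    ∑ k ∈ Finset.range (L + 1), lpKer Φ k y = dil Φ L y := by
  induction L with
  | zero => simp [lpKer, dil_zero]
  | succ L ih => rw [Finset.sum_range_succ, ih]; simp [lpKer]

theorem norm_dil_le_of_decay {Φ : ℝ → ℂ} {C : ℝ}
    (hC : ∀ y, ‖Φ y‖ ≤ C * ((1 + |y|) ^ 7)⁻¹) (a : ℕ) (y : ℝ) :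
    ‖dil Φ a y‖ ≤ C * ((2 : ℝ) ^ a * ((1 + (2 : ℝ) ^ a * |y|) ^ 7)⁻¹) := by
  unfold dil
  have := hC ((2 : ℝ) ^ a * y)
  rw [abs_mul, abs_of_pos (by positivity : (0 : ℝ) < 2 ^ a)] at this
  rw [norm_mul, norm_pow, Complex.norm_two]
  calc _ ≤ (2 : ℝ) ^ a * (C * ((1 + (2 : ℝ) ^ a * |y|) ^ 7)⁻¹) := by gcongr
    _ = _ := by ring

theorem exists_schwartz_decay (Φ : SchwartzMap ℝ ℂ) : ∃ C : ℝ, 0 < C ∧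
    (∀ y, ‖Φ y‖ ≤ C * ((1 + |y|) ^ 7)⁻¹) ∧ ∀ y, ‖fderiv ℝ Φ y‖ ≤ C * ((1 + |y|) ^ 7)⁻¹ := by
  set D : ℝ := 2 ^ 7 * (Finset.Iic ((7, 1) : ℕ × ℕ)).sup
    (fun m => SchwartzMap.seminorm ℝ m.1 m.2) Φ with hD
  have hD0 : 0 ≤ D := by positivity
  refine ⟨D + 1, by linarith, fun y => ?_, fun y => ?_⟩
  · have := SchwartzMap.one_add_le_sup_seminorm_apply (𝕜 := ℝ) (m := (7, 1)) (k := 7) (n := 0)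
      le_rfl (by norm_num) Φ y
    rw [norm_iteratedFDeriv_zero, Real.norm_eq_abs] at this
    rw [← div_eq_mul_inv, le_div_iff₀ (by positivity), mul_comm]
    exact this.trans (show D ≤ D + 1 by linarith)
  · have := SchwartzMap.one_add_le_sup_seminorm_apply (𝕜 := ℝ) (m := (7, 1)) (k := 7) (n := 1)
      le_rfl (by norm_num) Φ y
    rw [norm_iteratedFDeriv_one, Real.norm_eq_abs] at this
    rw [← div_eq_mul_inv, le_div_iff₀ (by positivity), mul_comm]
    exact this.trans (show D ≤ D + 1 by linarith)

theorem exists_norm_dil_le (Φ : SchwartzMap ℝ ℂ) (a : ℕ) : ∃ M, ∀ t, ‖dil Φ a t‖ ≤ M := by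
  obtain ⟨C, hC0, hC, -⟩ := exists_schwartz_decay Φ
  refine ⟨C * 2 ^ a, fun t => (norm_dil_le_of_decay hC _ _).trans ?_⟩
  gcongr
  refine mul_le_of_le_one_right (by positivity) (inv_le_one_of_one_le₀ (one_le_pow₀ ?_))
  have : 0 ≤ (2 : ℝ) ^ a * |t| := by positivity
  linarith

/-- Decay of the Littlewood-Paley kernels. -/
theorem exists_norm_lpKer_le (Φ : SchwartzMap ℝ ℂ) : ∃ C : ℝ, 0 < C ∧ ∀ k y,
    ‖lpKer Φ k y‖ ≤ C * ((2 : ℝ) ^ k * ((1 + (2 : ℝ) ^ k * |y|) ^ 7)⁻¹) := by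
  obtain ⟨C, hC0, hC, -⟩ := exists_schwartz_decay Φ
  refine ⟨C + C * 2 ^ 7, by positivity, fun k y => ?_⟩
  have hd := norm_dil_le_of_decay hC
  have hnn : 0 ≤ C * ((2 : ℝ) ^ k * ((1 + (2 : ℝ) ^ k * |y|) ^ 7)⁻¹) := by positivity
  rcases k with _ | k
  · have := hd 0 y
    simp only [lpKer, if_true]
    rw [dil_zero] at this
    nlinarith
  · simp only [lpKer, Nat.add_eq_zero_iff, one_ne_zero, and_false, if_false, Nat.add_sub_cancel]
    have h1 := hd (k + 1) y
    have h2 := hd k y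
    have h3 : ((1 + (2 : ℝ) ^ k * |y|) ^ 7)⁻¹ ≤ 2 ^ 7 * ((1 + (2 : ℝ) ^ (k + 1) * |y|) ^ 7)⁻¹ := by
      rw [← div_eq_mul_inv, ← div_pow, ← inv_pow]
      gcongr
      rw [inv_le_comm₀ (by positivity) (by positivity), inv_div, pow_succ]
      linarith
    have h4 : (2 : ℝ) ^ k ≤ 2 ^ (k + 1) := by gcongr <;> norm_num
    calc _ ≤ _ := norm_sub_le _ _
      _ ≤ C * ((2 : ℝ) ^ (k + 1) * ((1 + (2 : ℝ) ^ (k + 1) * |y|) ^ 7)⁻¹) +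
          C * ((2 : ℝ) ^ (k + 1) * (2 ^ 7 * ((1 + (2 : ℝ) ^ (k + 1) * |y|) ^ 7)⁻¹)) := by
          refine add_le_add h1 (h2.trans ?_)
          gcongr
      _ = _ := by ring

/-- Lipschitz estimate for dilates. -/
theorem exists_norm_dil_sub_le (Φ : SchwartzMap ℝ ℂ) : ∃ C : ℝ, 0 < C ∧ ∀ (a : ℕ) (x y : ℝ),
    (2 : ℝ) ^ a * |x - y| ≤ 2 → ‖dil Φ a x - dil Φ a y‖ ≤
      C * ((2 : ℝ) ^ a * |x - y|) * ((2 : ℝ) ^ a * ((1 + (2 : ℝ) ^ a * |x|) ^ 7)⁻¹) := by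
  obtain ⟨C, hC0, -, hC⟩ := exists_schwartz_decay Φ
  have key : ∀ x y : ℝ, |x - y| ≤ 2 → ‖Φ x - Φ y‖ ≤ C * 3 ^ 7 * ((1 + |x|) ^ 7)⁻¹ * |x - y| := by
    intro x y hxy
    have := (convex_closedBall x 2).norm_image_sub_le_of_norm_fderiv_le (𝕜 := ℝ) (f := Φ)
      (C := C * 3 ^ 7 * ((1 + |x|) ^ 7)⁻¹) (x := y) (y := x)
      (fun z _ => Φ.differentiableAt) (fun z hz => ?_) (by
        rw [Metric.mem_closedBall, Real.dist_eq, abs_sub_comm]; exact hxy)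
        (Metric.mem_closedBall_self (by norm_num))
    · exact this
    · refine (hC z).trans ?_
      rw [mul_assoc]
      gcongr
      rw [Metric.mem_closedBall, Real.dist_eq] at hz
      rw [← div_eq_mul_inv, ← div_pow, ← inv_pow]
      gcongr
      rw [inv_le_comm₀ (by positivity) (by positivity), inv_div]
      have := abs_sub_abs_le_abs_sub x z
      rw [abs_sub_comm] at this
      linarith [abs_nonneg z]
  refine ⟨C * 3 ^ 7, by positivity, fun a x y hxy => ?_⟩
  have h2 : (0 : ℝ) < 2 ^ a := by positivity
  have e : |(2 : ℝ) ^ a * x - 2 ^ a * y| = 2 ^ a * |x - y| := by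
    rw [← mul_sub, abs_mul, abs_of_pos h2]
  have h := key ((2 : ℝ) ^ a * x) (2 ^ a * y) (by rwa [e])
  rw [e, abs_mul, abs_of_pos h2] at h
  unfold dil
  rw [← mul_sub, norm_mul, norm_pow, Complex.norm_two]
  calc _ ≤ (2 : ℝ) ^ a * _ := mul_le_mul_of_nonneg_left h h2.le
    _ = _ := by ring

theorem integral_lpKer_mul_dil {Φ : SchwartzMap ℝ ℂ}
    (hΦ : ∀ a b, b < a → ∀ x, ∫ t, dil Φ b t * dil Φ a (x - t) = dil Φ b x) (l : ℕ) (x : ℝ) :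
    ∫ t, lpKer Φ l t * dil Φ (l + 1) (x - t) = lpKer Φ l x := by
  obtain ⟨M, hM⟩ := exists_norm_dil_le Φ (l + 1)
  have hint : ∀ b, Integrable fun t => dil Φ b t * dil Φ (l + 1) (x - t) := fun b =>
    (integrable_dil Φ b).mul_bdd (c := M)
      ((continuous_dil Φ _).comp (continuous_const.sub continuous_id)).aestronglyMeasurable
      (.of_forall fun t => hM _)
  rcases l with _ | l
  · simpa [lpKer, dil_zero] using hΦ 1 0 (by norm_num) x
  · simp only [lpKer, Nat.add_eq_zero_iff, one_ne_zero, and_false, if_false, Nat.add_sub_cancel,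
      sub_mul]
    rw [integral_sub (hint _) (hint _), hΦ _ _ (by lia), hΦ _ _ (by lia)]

theorem measurable_conv {f g : ℝ → ℂ} (hf : Measurable f) (hg : Measurable g) :
    Measurable (conv f g) := by
  have : StronglyMeasurable fun z : ℝ × ℝ => f z.2 * g (z.1 - z.2) :=
    ((hf.comp measurable_snd).mul (hg.comp (measurable_fst.sub measurable_snd))).stronglyMeasurable
  exact this.integral_prod_right'.measurable

theorem integrable_conv {f g : ℝ → ℂ} (hf : Integrable f) (hg : Integrable g) :
    Integrable (conv f g) :=
  hf.integrable_convolution (ContinuousLinearMap.mul ℂ ℂ) hg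

/-- The reproducing formula for Littlewood-Paley pieces. -/
theorem conv_lpKer_reproduce {Φ : SchwartzMap ℝ ℂ}
    (hΦ : ∀ a b, b < a → ∀ x, ∫ t, dil Φ b t * dil Φ a (x - t) = dil Φ b x)
    {f : ℝ → ℂ} (hf : Integrable f) (l : ℕ) (y : ℝ) :
    ∫ t, conv f (lpKer Φ l) t * dil Φ (l + 1) (y - t) = conv f (lpKer Φ l) y := by
  obtain ⟨M, hM⟩ := exists_norm_dil_le Φ (l + 1)
  have hi : Integrable (fun z : ℝ × ℝ => f z.2 * lpKer Φ l (z.1 - z.2)) (volume.prod volume) :=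
    hf.convolution_integrand (ContinuousLinearMap.mul ℂ ℂ) (integrable_lpKer Φ l)
  have hi2 : Integrable (fun z : ℝ × ℝ => f z.2 * lpKer Φ l (z.1 - z.2) * dil Φ (l + 1) (y - z.1))
      (volume.prod volume) :=
    hi.mul_bdd (c := M) ((continuous_dil Φ _).comp
      (continuous_const.sub continuous_fst)).aestronglyMeasurable (.of_forall fun t => hM _)
  unfold conv
  simp only [← integral_mul_const]
  rw [integral_integral_swap (f := fun t z => f z * lpKer Φ l (t - z) * dil Φ (l + 1) (y - t)) hi2]
  refine integral_congr_ae (.of_forall fun z => ?_)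
  simp only [mul_assoc]
  rw [integral_const_mul]
  congr 1
  rw [← integral_lpKer_mul_dil hΦ l (y - z),
    ← integral_sub_right_eq_self (fun t => lpKer Φ l t * dil Φ (l + 1) (y - z - t)) z]
  refine integral_congr_ae (.of_forall fun t => ?_)
  simp only [sub_sub_sub_cancel_right]

theorem haarFn_eq_indicator (j : ℕ) (μ : ℤ) (x : ℝ) : haarFn j μ x =
    (dyadicIdx (j + 1) ⁻¹' {2 * μ}).indicator (fun _ => (1 : ℂ)) x -
      (dyadicIdx (j + 1) ⁻¹' {2 * μ + 1}).indicator (fun _ => (1 : ℂ)) x := by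
  have h2 : (2 : ℝ) ^ (-((j : ℤ) + 1)) = 2 ^ (-(j : ℤ)) / 2 := by
    rw [neg_add, zpow_add₀ (by norm_num), zpow_neg_one]; rfl
  have e1 : (2 : ℝ) ^ (-(j : ℤ)) / 2 * (2 * μ) = 2 ^ (-(j : ℤ)) * μ := by ring
  have e2 : (2 : ℝ) ^ (-(j : ℤ)) / 2 * (2 * μ + 1) = 2 ^ (-(j : ℤ)) * (μ + 1 / 2) := by ring
  have e3 : (2 : ℝ) ^ (-(j : ℤ)) / 2 * (2 * μ + 1 + 1) = 2 ^ (-(j : ℤ)) * (μ + 1) := by ring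
  rw [haarFn, dyadic_fiber_eq, dyadic_fiber_eq, h2]
  push_cast
  rw [e1, e2, e3]

theorem isDyadicStep_haarFn (j : ℕ) (μ : ℤ) : IsDyadicStep (j + 1) (haarFn j μ) := by
  intro x y h
  rw [haarFn_eq_indicator, haarFn_eq_indicator]
  simp only [Set.indicator, Set.mem_preimage, h]

theorem haarFn_eq_zero {j : ℕ} {μ : ℤ} {x : ℝ} (h : dyadicIdx j x ≠ μ) : haarFn j μ x = 0 := by
  have hd := dyadicIdx_eq_div j 1 x
  rw [haarFn_eq_indicator]
  simp only [Nat.cast_one, pow_one, Nat.cast_ofNat] at hd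
  rw [Set.indicator_of_notMem, Set.indicator_of_notMem, sub_zero]
  · intro h'
    simp only [Set.mem_preimage, Set.mem_singleton_iff] at h'
    lia
  · intro h'
    simp only [Set.mem_preimage, Set.mem_singleton_iff] at h'
    lia

theorem norm_haarFn_le (j : ℕ) (μ : ℤ) (x : ℝ) : ‖haarFn j μ x‖ ≤ 1 := by
  rw [haarFn_eq_indicator]
  simp only [Set.indicator, Set.mem_preimage, Set.mem_singleton_iff]
  split_ifs with h1 h2
  · lia
  all_goals simp

theorem measurable_haarFn (j : ℕ) (μ : ℤ) : Measurable (haarFn j μ) :=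
  (isDyadicStep_haarFn j μ).measurable

theorem enorm_haarFn_le (j : ℕ) (μ : ℤ) (x : ℝ) :
    ‖haarFn j μ x‖ₑ ≤ (dyadicIdx j ⁻¹' {μ}).indicator 1 x := by
  by_cases h : dyadicIdx j x = μ
  · rw [Set.indicator_of_mem (by simpa using h), ← ofReal_norm]
    exact ENNReal.ofReal_le_one.2 (norm_haarFn_le j μ x)
  · simp [haarFn_eq_zero h]

theorem integrable_haarFn (j : ℕ) (μ : ℤ) : Integrable (haarFn j μ) := by
  refine ⟨(measurable_haarFn j μ).aestronglyMeasurable, ?_⟩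
  refine lt_of_le_of_lt (lintegral_mono (enorm_haarFn_le j μ)) ?_
  rw [lintegral_indicator_one (measurable_dyadicIdx _ (measurableSet_singleton μ)),
    volume_dyadic_fiber]
  exact ENNReal.ofReal_lt_top

theorem integral_haarFn (j : ℕ) (μ : ℤ) : ∫ x, haarFn j μ x = 0 := by
  have hm : ∀ ν, MeasurableSet (dyadicIdx (j + 1) ⁻¹' {ν}) := fun ν =>
    measurable_dyadicIdx _ (measurableSet_singleton ν)
  have hi : ∀ ν, Integrable ((dyadicIdx (j + 1) ⁻¹' {ν}).indicator (fun _ => (1 : ℂ))) := fun ν =>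
    (integrable_indicator_iff (hm ν)).2 (integrableOn_const (by
      rw [volume_dyadic_fiber]; exact ENNReal.ofReal_ne_top))
  simp only [haarFn_eq_indicator]
  rw [integral_sub (hi _) (hi _), integral_indicator_const _ (hm _),
    integral_indicator_const _ (hm _), measureReal_def, measureReal_def, volume_dyadic_fiber,
    volume_dyadic_fiber, sub_self]

/-- The part of the Haar projection living on the level `j`. -/
def levelProj (E : Finset (ℕ × ℤ)) (j : ℕ) (f : ℝ → ℂ) : ℝ → ℂ :=
  haarProj (E.filter fun e => e.1 = j) f

theorem isDyadicStep_levelProj (E : Finset (ℕ × ℤ)) (j : ℕ) (f : ℝ → ℂ) :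
    IsDyadicStep (j + 1) (levelProj E j f) := by
  intro x y h
  unfold levelProj haarProj
  refine Finset.sum_congr rfl fun e he => ?_
  have : e.1 = j := (Finset.mem_filter.1 he).2
  subst this
  rw [isDyadicStep_haarFn e.1 e.2 x y h]

theorem integrable_haarProj (E : Finset (ℕ × ℤ)) (f : ℝ → ℂ) : Integrable (haarProj E f) :=
  integrable_finsetSum _ fun e _ => (integrable_haarFn e.1 e.2).const_mul _

theorem levelProj_eq_zero {E : Finset (ℕ × ℤ)} {j : ℕ} (hj : j ∉ HFset E) (f : ℝ → ℂ) (x : ℝ) :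
    levelProj E j f x = 0 := by
  unfold levelProj haarProj
  rw [Finset.filter_false_of_mem, Finset.sum_empty]
  rintro e he rfl
  exact hj (Finset.mem_image_of_mem _ he)

theorem norm_levelProj_le (E : Finset (ℕ × ℤ)) (j : ℕ) (f : ℝ → ℂ) (x : ℝ) :
    ‖levelProj E j f x‖ ≤ (2 : ℝ) ^ j * ‖∫ y, f y * haarFn j (dyadicIdx j x) y‖ := by
  unfold levelProj haarProj
  have h0 : ∀ e ∈ E.filter (fun e => e.1 = j), e ≠ (j, dyadicIdx j x) →
      (2 : ℂ) ^ e.1 * (∫ y, f y * haarFn e.1 e.2 y) * haarFn e.1 e.2 x = 0 := by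
    intro e he hne
    have : e.1 = j := (Finset.mem_filter.1 he).2
    subst this
    rw [haarFn_eq_zero, mul_zero]
    intro h
    exact hne (Prod.ext rfl h.symm)
  by_cases hmem : (j, dyadicIdx j x) ∈ E.filter (fun e => e.1 = j)
  · rw [Finset.sum_eq_single_of_mem _ hmem h0, norm_mul, norm_mul, norm_pow, Complex.norm_two]
    exact mul_le_of_le_one_right (by positivity) (norm_haarFn_le _ _ _)
  · rw [Finset.sum_eq_zero fun e he => h0 e he fun h => hmem (h ▸ he)]
    simp only [norm_zero]; positivity

theorem abs_dyadicIdx_sub_le (l : ℤ) (x y : ℝ) :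
    |((dyadicIdx l x - dyadicIdx l y : ℤ) : ℝ)| ≤ 1 + (2 : ℝ) ^ l * |x - y| := by
  unfold dyadicIdx
  have h1 := Int.floor_le ((2 : ℝ) ^ l * x)
  have h2 := Int.lt_floor_add_one ((2 : ℝ) ^ l * x)
  have h3 := Int.floor_le ((2 : ℝ) ^ l * y)
  have h4 := Int.lt_floor_add_one ((2 : ℝ) ^ l * y)
  have e : (2 : ℝ) ^ l * |x - y| = |2 ^ l * x - 2 ^ l * y| := by
    rw [← mul_sub, abs_mul, abs_of_pos (by positivity : (0 : ℝ) < 2 ^ l)]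
  rw [e]
  push_cast
  have h5 := le_abs_self ((2 : ℝ) ^ l * x - 2 ^ l * y)
  have h6 := neg_le_abs ((2 : ℝ) ^ l * x - 2 ^ l * y)
  rw [abs_le]
  constructor <;> linarith

theorem inv_bracket_le_cubicWeight {l : ℤ} {k : ℝ} (hlk : (2 : ℝ) ^ l ≤ k) (x y : ℝ) :
    ((1 + k * |x - y|) ^ 3)⁻¹ ≤ 8 * cubicWeight (dyadicIdx l x - dyadicIdx l y) := by
  have h := abs_dyadicIdx_sub_le l x y
  have h0 : (2 : ℝ) ^ l * |x - y| ≤ k * |x - y| := by gcongr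
  have h2 : (0 : ℝ) ≤ 2 ^ l * |x - y| := by positivity
  unfold cubicWeight
  rw [show (8 : ℝ) = 2 ^ 3 by norm_num, ← div_eq_mul_inv, ← div_pow, ← inv_pow]
  gcongr
  · exact inv_nonneg.2 (by linarith)
  rw [inv_le_comm₀ (by linarith) (by positivity), inv_div]
  linarith

theorem inv_pow_bracket_anti {t : ℝ} (ht : 0 ≤ t) : ((1 + t) ^ 7)⁻¹ ≤ ((1 + t) ^ 3)⁻¹ := by
  gcongr
  · linarith
  · norm_num

/-- Low-pass estimate: Littlewood-Paley pieces are controlled by averages at the same scale. -/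
theorem enorm_conv_lpKer_le (Φ : SchwartzMap ℝ ℂ) : ∃ C : ℝ, 0 < C ∧
    ∀ (k : ℕ) (g : ℝ → ℂ), Measurable g → ∀ x,
      ‖conv g (lpKer Φ k) x‖ₑ ≤ ENNReal.ofReal C * avgOp k (fun y => ‖g y‖ₑ) x := by
  obtain ⟨C, hC0, hC⟩ := exists_norm_lpKer_le Φ
  refine ⟨8 * C, by positivity, fun k g hg x => ?_⟩
  rw [← avgOp_const_mul _ hg.enorm]
  unfold conv avgOp
  refine (enorm_integral_le_lintegral_enorm _).trans (lintegral_mono fun t => ?_)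
  rw [enorm_mul, ← mul_assoc, mul_comm]
  gcongr
  rw [← ofReal_norm, ← ENNReal.ofReal_mul (by have := cubicWeight_pos (dyadicIdx k x - dyadicIdx k t); positivity)]
  refine ENNReal.ofReal_le_ofReal ((hC k _).trans ?_)
  have h1 := inv_pow_bracket_anti (t := (2 : ℝ) ^ k * |x - t|) (by positivity)
  have h2 := inv_bracket_le_cubicWeight (l := k) (k := (2 : ℝ) ^ k) (by simp) x t
  rw [zpow_natCast]
  calc _ ≤ C * ((2 : ℝ) ^ k * (8 * cubicWeight (dyadicIdx k x - dyadicIdx k t))) := by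
        gcongr; exact h1.trans h2
    _ = _ := by ring

theorem enorm_two_pow_mul (j : ℕ) (z : ℂ) :
    ENNReal.ofReal ((2 : ℝ) ^ j * ‖z‖) = ENNReal.ofReal ((2 : ℝ) ^ j) * ‖z‖ₑ := by
  rw [ENNReal.ofReal_mul (by positivity), ofReal_norm]

/-- Haar coefficients are controlled by averages at the Haar scale. -/
theorem enorm_levelProj_le (E : Finset (ℕ × ℤ)) (j : ℕ) (g : ℝ → ℂ) (x : ℝ) :
    ‖levelProj E j g x‖ₑ ≤ avgOp j (fun y => ‖g y‖ₑ) x := by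
  rw [← ofReal_norm]
  refine (ENNReal.ofReal_le_ofReal (norm_levelProj_le E j g x)).trans ?_
  rw [enorm_two_pow_mul]
  refine (mul_le_mul_right (enorm_integral_le_lintegral_enorm _) _).trans ?_
  rw [← lintegral_const_mul' _ _ ENNReal.ofReal_ne_top]
  unfold avgOp
  refine lintegral_mono fun y => ?_
  by_cases h : dyadicIdx j y = dyadicIdx j x
  · simp only [h, sub_self, cubicWeight_zero, mul_one, zpow_natCast]
    gcongr
    rw [enorm_mul]
    refine mul_le_of_le_one_right zero_le ((enorm_haarFn_le _ _ _).trans ?_)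
    exact Set.indicator_apply_le' (fun _ => le_rfl) (fun _ => zero_le)
  · rw [haarFn_eq_zero h]; simp

theorem abs_sub_le_of_dyadicIdx_eq {j : ℤ} {x y : ℝ} (h : dyadicIdx j x = dyadicIdx j y) :
    |x - y| ≤ (2 : ℝ) ^ (-j) := by
  have hx : x ∈ dyadicIdx j ⁻¹' {dyadicIdx j y} := h
  have hy : y ∈ dyadicIdx j ⁻¹' {dyadicIdx j y} := rfl
  rw [dyadic_fiber_eq, Set.mem_Ico] at hx hy
  rw [abs_le]
  constructor <;> linarith [hx.1, hx.2, hy.1, hy.2]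

/-- Band-limited functions vary slowly below their scale. -/
theorem enorm_conv_lpKer_sub_le (Φ : SchwartzMap ℝ ℂ)
    (hΦ : ∀ a b : ℕ, b < a → ∀ x, ∫ t, dil Φ b t * dil Φ a (x - t) = dil Φ b x) :
    ∃ C : ℝ, 0 < C ∧ ∀ (l : ℕ) (f : ℝ → ℂ), Measurable f → Integrable f →
    ∀ x y, (2 : ℝ) ^ l * |x - y| ≤ 1 →
      ‖conv f (lpKer Φ l) y - conv f (lpKer Φ l) x‖ₑ ≤
        ENNReal.ofReal (C * (2 ^ l * |x - y|)) *
          avgOp l (fun t => ‖conv f (lpKer Φ l) t‖ₑ) x := by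
  obtain ⟨C, hC0, hC⟩ := exists_norm_dil_sub_le Φ
  refine ⟨32 * C, by positivity, fun l f hfm hf x y hxy => ?_⟩
  have hg : Integrable (conv f (lpKer Φ l)) := integrable_conv hf (integrable_lpKer Φ l)
  have hgm : Measurable (conv f (lpKer Φ l)) :=
    measurable_conv hfm (continuous_lpKer Φ l).measurable
  have hint : ∀ z, Integrable fun t => conv f (lpKer Φ l) t * dil Φ (l + 1) (z - t) := by
    intro z
    obtain ⟨M, hM⟩ := exists_norm_dil_le Φ (l + 1)
    refine hg.mul_bdd (c := M) ?_ (Filter.Eventually.of_forall fun t => hM _)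
    exact ((continuous_dil Φ (l + 1)).comp (by fun_prop)).aestronglyMeasurable
  rw [← neg_sub, enorm_neg, ← conv_lpKer_reproduce hΦ hf l x, ← conv_lpKer_reproduce hΦ hf l y,
    ← integral_sub (hint x) (hint y), ← avgOp_const_mul _ hgm.enorm]
  refine (enorm_integral_le_lintegral_enorm _).trans (lintegral_mono fun t => ?_)
  rw [← mul_sub, enorm_mul, ← mul_assoc, mul_comm]
  gcongr
  rw [← ofReal_norm, ← ENNReal.ofReal_mul (by have := cubicWeight_pos (dyadicIdx l x - dyadicIdx l t); positivity)]
  have e : x - t - (y - t) = x - y := by ring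
  have h0 := hC (l + 1) (x - t) (y - t) (by rw [e, pow_succ]; linarith)
  rw [e] at h0
  refine ENNReal.ofReal_le_ofReal (h0.trans ?_)
  have h1 := inv_pow_bracket_anti (t := (2 : ℝ) ^ (l + 1) * |x - t|) (by positivity)
  have h2 := inv_bracket_le_cubicWeight (l := l) (k := (2 : ℝ) ^ (l + 1))
    (by rw [zpow_natCast, pow_succ]; linarith [pow_pos (zero_lt_two (α := ℝ)) l]) x t
  rw [zpow_natCast]
  calc _ ≤ C * (2 ^ (l + 1) * |x - y|) *
        (2 ^ (l + 1) * (8 * cubicWeight (dyadicIdx l x - dyadicIdx l t))) := by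
        gcongr; exact h1.trans h2
    _ = _ := by ring

/-- Haar coefficients of low frequency pieces decay. -/
theorem enorm_levelProj_conv_le (Φ : SchwartzMap ℝ ℂ)
    (hΦ : ∀ a b : ℕ, b < a → ∀ x, ∫ t, dil Φ b t * dil Φ a (x - t) = dil Φ b x) :
    ∃ C : ℝ, 0 < C ∧ ∀ (E : Finset (ℕ × ℤ)) (j l : ℕ), l ≤ j → ∀ f : ℝ → ℂ, Measurable f →
      Integrable f → ∀ x,
      ‖levelProj E j (conv f (lpKer Φ l)) x‖ₑ ≤
        ENNReal.ofReal (C * (2 ^ l * 2 ^ (-(j : ℤ)))) *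
          avgOp l (fun t => ‖conv f (lpKer Φ l) t‖ₑ) x := by
  obtain ⟨C, hC0, hC⟩ := enorm_conv_lpKer_sub_le Φ hΦ
  refine ⟨C, hC0, fun E j l hlj f hfm hf x => ?_⟩
  set g := conv f (lpKer Φ l) with hgdef
  have hg : Integrable g := integrable_conv hf (integrable_lpKer Φ l)
  have hl : (2 : ℝ) ^ l * 2 ^ (-(j : ℤ)) ≤ 1 := by
    rw [zpow_neg, zpow_natCast, ← div_eq_mul_inv, div_le_one (by positivity)]
    exact pow_le_pow_right₀ one_le_two hlj
  have hgh : Integrable fun y => g y * haarFn j (dyadicIdx j x) y :=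
    hg.mul_bdd (c := 1) (measurable_haarFn _ _).aestronglyMeasurable
      (Filter.Eventually.of_forall fun t => norm_haarFn_le _ _ _)
  have e1 : ∫ y, g y * haarFn j (dyadicIdx j x) y =
      ∫ y, (g y - g x) * haarFn j (dyadicIdx j x) y := by
    simp only [sub_mul]
    rw [integral_sub hgh ((integrable_haarFn _ _).const_mul _), integral_const_mul,
      integral_haarFn, mul_zero, sub_zero]
  rw [← ofReal_norm]
  refine (ENNReal.ofReal_le_ofReal (norm_levelProj_le E j g x)).trans ?_
  rw [enorm_two_pow_mul, e1]
  set D := ENNReal.ofReal (C * (2 ^ l * 2 ^ (-(j : ℤ)))) * avgOp l (fun t => ‖g t‖ₑ) x with hD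
  have h2 : ‖∫ y, (g y - g x) * haarFn j (dyadicIdx j x) y‖ₑ ≤
      D * ENNReal.ofReal (2 ^ (-(j : ℤ))) := by
    refine (enorm_integral_le_lintegral_enorm _).trans ?_
    rw [← volume_dyadic_fiber j (dyadicIdx j x), ← setLIntegral_const,
      ← lintegral_indicator (measurable_dyadicIdx _ (measurableSet_singleton _))]
    refine lintegral_mono fun y => ?_
    by_cases h : dyadicIdx j y = dyadicIdx j x
    · rw [Set.indicator_of_mem (by exact h), enorm_mul]
      have hh : ‖haarFn j (dyadicIdx j x) y‖ₑ ≤ 1 := by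
        rw [← ofReal_norm]; exact ENNReal.ofReal_le_one.2 (norm_haarFn_le _ _ _)
      refine (mul_le_of_le_one_right zero_le hh).trans ?_
      have hd := abs_sub_le_of_dyadicIdx_eq h.symm
      have hxy : (2 : ℝ) ^ l * |x - y| ≤ 2 ^ l * 2 ^ (-(j : ℤ)) := by gcongr
      refine (hC l f hfm hf x y (hxy.trans hl)).trans ?_
      rw [hD]
      gcongr
    · rw [haarFn_eq_zero h]; simp
  calc _ ≤ ENNReal.ofReal (2 ^ j) * (D * ENNReal.ofReal (2 ^ (-(j : ℤ)))) := by gcongr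
    _ = D * (ENNReal.ofReal (2 ^ j) * ENNReal.ofReal (2 ^ (-(j : ℤ)))) := by ring
    _ = D := by
      rw [← ENNReal.ofReal_mul (by positivity), zpow_neg, zpow_natCast,
        mul_inv_cancel₀ (by positivity), ENNReal.ofReal_one, mul_one]

theorem edgeWeight_nonneg (k i : ℤ) (x : ℝ) : 0 ≤ edgeWeight k i x := by
  unfold edgeWeight; positivity

theorem inv_bracket_le_edgeWeight (k : ℤ) {i : ℤ} {x t : ℝ} (h : dyadicIdx i t ≠ dyadicIdx i x) :
    ((1 + (2 : ℝ) ^ k * |x - t|) ^ 2)⁻¹ ≤ edgeWeight k i x := by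
  have hx := endpoint_le i x
  have hx' := le_endpoint i x
  have ht := endpoint_le i t
  have ht' := le_endpoint i t
  have h2 : (0 : ℝ) < 2 ^ (-i) := by positivity
  have hmin := le_min hx hx'
  unfold edgeWeight
  gcongr
  rcases lt_or_gt_of_ne h with h | h
  · refine (min_le_left _ _).trans (le_trans ?_ (le_abs_self _))
    have : ((dyadicIdx i t + 1 : ℤ) : ℝ) ≤ dyadicIdx i x := by exact_mod_cast h
    push_cast at this
    nlinarith
  · refine (min_le_right _ _).trans (le_trans ?_ (neg_le_abs _))
    have : ((dyadicIdx i x + 1 : ℤ) : ℝ) ≤ dyadicIdx i t := by exact_mod_cast h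
    push_cast at this
    nlinarith

theorem setLIntegral_enorm_step {i : ℤ} {g : ℝ → ℂ} (hg : IsDyadicStep i g) (ν : ℤ) :
    ENNReal.ofReal ((2 : ℝ) ^ i) * ∫⁻ y in dyadicIdx i ⁻¹' {ν}, ‖g y‖ₑ =
      ‖g ((2 : ℝ) ^ (-i) * ν)‖ₑ := by
  have hm : MeasurableSet (dyadicIdx i ⁻¹' {ν}) := measurable_dyadicIdx i (measurableSet_singleton ν)
  rw [setLIntegral_congr_fun (g := fun _ => ‖g ((2 : ℝ) ^ (-i) * ν)‖ₑ) hm, setLIntegral_const,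
    volume_dyadic_fiber, mul_left_comm, ← ENNReal.ofReal_mul (by positivity),
    ← zpow_add₀ (by norm_num), add_neg_cancel, zpow_zero, ENNReal.ofReal_one, mul_one]
  intro y hy
  have hy' : dyadicIdx i y = ν := hy
  show ‖g y‖ₑ = _
  rw [hg.eq_comp y, hy']

theorem avgOp_step {i : ℤ} {g : ℝ → ℂ} (hg : IsDyadicStep i g) (x : ℝ) :
    avgOp i (fun y => ‖g y‖ₑ) x = ∑' ν : ℤ, ENNReal.ofReal (cubicWeight (dyadicIdx i x - ν)) *
      ‖g ((2 : ℝ) ^ (-i) * ν)‖ₑ := by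
  rw [avgOp_eq_tsum i hg.measurable.enorm]
  simp only [setLIntegral_enorm_step hg]

theorem enorm_le_avgOp_step {i : ℤ} {g : ℝ → ℂ} (hg : IsDyadicStep i g) (x : ℝ) :
    ‖g x‖ₑ ≤ avgOp i (fun y => ‖g y‖ₑ) x := by
  rw [avgOp_step hg, hg.eq_comp x]
  refine le_trans ?_ (ENNReal.le_tsum (dyadicIdx i x))
  simp [cubicWeight_zero]

theorem exists_norm_lpKer_bound (Φ : SchwartzMap ℝ ℂ) (k : ℕ) : ∃ M, ∀ t, ‖lpKer Φ k t‖ ≤ M := by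
  obtain ⟨C, hC0, hC⟩ := exists_norm_lpKer_le Φ
  refine ⟨C * 2 ^ k, fun t => (hC k t).trans ?_⟩
  gcongr
  refine mul_le_of_le_one_right (by positivity) (inv_le_one_of_one_le₀ (one_le_pow₀ ?_))
  have : 0 ≤ (2 : ℝ) ^ k * |t| := by positivity
  linarith

theorem integrable_mul_lpKer (Φ : SchwartzMap ℝ ℂ) (k : ℕ) {g : ℝ → ℂ} (hg : Integrable g) (x : ℝ) :
    Integrable fun t => g t * lpKer Φ k (x - t) := by
  obtain ⟨M, hM⟩ := exists_norm_lpKer_bound Φ k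
  exact hg.mul_bdd (c := M) ((continuous_lpKer Φ k).comp (by fun_prop)).aestronglyMeasurable
    (Filter.Eventually.of_forall fun t => hM _)

/-- High-pass estimate: high frequency pieces of a step function concentrate near the jumps. -/
theorem enorm_conv_step_le (Φ : SchwartzMap ℝ ℂ) : ∃ C : ℝ, 0 < C ∧
    ∀ (k : ℕ) (i : ℤ), 1 ≤ k → i ≤ k → ∀ g : ℝ → ℂ, Integrable g → IsDyadicStep i g → ∀ x,
      ‖conv g (lpKer Φ k) x‖ₑ ≤ ENNReal.ofReal C *
        (ENNReal.ofReal (edgeWeight k i x) * avgOp i (fun y => ‖g y‖ₑ) x) := by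
  obtain ⟨C, hC0, hC⟩ := exists_norm_lpKer_le Φ
  have hbM := bracketMass_lt_top
  refine ⟨8 * C * (bracketMass.toReal + 1) * (1 + weightSum),
    by have := one_le_weightSum; positivity, fun k i hk hik g hg hgs x => ?_⟩
  set W : ℝ → ℝ≥0∞ := fun t => ENNReal.ofReal ((2 : ℝ) ^ k * ((1 + (2 : ℝ) ^ k * |x - t|) ^ 2)⁻¹)
    with hW
  have hWm : Measurable W := by rw [hW]; fun_prop
  have hWint : ∫⁻ t, W t = bracketMass := by
    have e : ∀ t, W t = ENNReal.ofReal ((2 : ℝ) ^ k) *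
        ENNReal.ofReal ((1 + |(2 : ℝ) ^ (k : ℤ) * (t - x)|) ^ 2)⁻¹ := by
      intro t
      rw [hW, ← ENNReal.ofReal_mul (by positivity), abs_mul, abs_sub_comm t x, zpow_natCast,
        abs_of_pos (by positivity : (0 : ℝ) < 2 ^ k)]
    simp only [e]
    rw [lintegral_const_mul' _ _ ENNReal.ofReal_ne_top, lintegral_scaled_bracket, ← mul_assoc,
      ← ENNReal.ofReal_mul (by positivity), zpow_neg, zpow_natCast,
      mul_inv_cancel₀ (by positivity), ENNReal.ofReal_one, one_mul]
  have hi1 := integrable_mul_lpKer Φ k hg x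
  have hi2 : Integrable fun t => g x * lpKer Φ k (x - t) :=
    ((integrable_lpKer Φ k).comp_sub_left x).const_mul _
  have e1 : conv g (lpKer Φ k) x = ∫ t, (g t - g x) * lpKer Φ k (x - t) := by
    simp only [sub_mul]
    rw [integral_sub hi1 hi2, integral_const_mul, integral_sub_left_eq_self (lpKer Φ k),
      integral_lpKer Φ hk, mul_zero, sub_zero]
    rfl
  set D := ENNReal.ofReal (8 * C * edgeWeight k i x) with hD
  have hedge := edgeWeight_nonneg k i x
  have hpt : ∀ t, ‖(g t - g x) * lpKer Φ k (x - t)‖ₑ ≤ D *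
      ((‖g t‖ₑ + ‖g x‖ₑ) * ENNReal.ofReal (cubicWeight (dyadicIdx i x - dyadicIdx i t)) * W t) := by
    intro t
    by_cases h : dyadicIdx i t = dyadicIdx i x
    · rw [hgs t x h]; simp
    have hcw := cubicWeight_pos (dyadicIdx i x - dyadicIdx i t)
    have e2 : D * ((‖g t‖ₑ + ‖g x‖ₑ) *
        ENNReal.ofReal (cubicWeight (dyadicIdx i x - dyadicIdx i t)) * W t) =
        (‖g t‖ₑ + ‖g x‖ₑ) * ENNReal.ofReal (8 * C * edgeWeight k i x *
          cubicWeight (dyadicIdx i x - dyadicIdx i t) *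
          ((2 : ℝ) ^ k * ((1 + (2 : ℝ) ^ k * |x - t|) ^ 2)⁻¹)) := by
      rw [ENNReal.ofReal_mul (by positivity), ENNReal.ofReal_mul (by positivity), hD, hW]
      ring
    rw [e2, enorm_mul]
    refine mul_le_mul' (enorm_sub_le) ?_
    rw [← ofReal_norm]
    refine ENNReal.ofReal_le_ofReal ((hC k _).trans ?_)
    have h1 := inv_bracket_le_edgeWeight k h
    have h2 := inv_bracket_le_cubicWeight (l := i) (k := (2 : ℝ) ^ k)
      (by rw [← zpow_natCast]; exact zpow_le_zpow_right₀ one_le_two hik) x t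
    rw [zpow_natCast] at h1
    calc C * ((2 : ℝ) ^ k * ((1 + (2 : ℝ) ^ k * |x - t|) ^ 7)⁻¹)
        = C * (((1 + (2 : ℝ) ^ k * |x - t|) ^ 3)⁻¹ * ((1 + (2 : ℝ) ^ k * |x - t|) ^ 2)⁻¹ *
          ((2 : ℝ) ^ k * ((1 + (2 : ℝ) ^ k * |x - t|) ^ 2)⁻¹)) := by
          rw [show 7 = 3 + 2 + 2 from rfl, pow_add, pow_add, mul_inv, mul_inv]; ring
      _ ≤ C * (8 * cubicWeight (dyadicIdx i x - dyadicIdx i t) * edgeWeight k i x *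
          ((2 : ℝ) ^ k * ((1 + (2 : ℝ) ^ k * |x - t|) ^ 2)⁻¹)) := by gcongr
      _ = _ := by ring
  set A := avgOp i (fun y => ‖g y‖ₑ) x with hA
  have hsum : ∫⁻ t, (‖g t‖ₑ + ‖g x‖ₑ) *
      ENNReal.ofReal (cubicWeight (dyadicIdx i x - dyadicIdx i t)) * W t ≤
      bracketMass * ((1 + ENNReal.ofReal weightSum) * A) := by
    rw [lintegral_eq_tsum_dyadic i]
    have hfib : ∀ ν : ℤ, ∫⁻ t in dyadicIdx i ⁻¹' {ν}, (‖g t‖ₑ + ‖g x‖ₑ) *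
        ENNReal.ofReal (cubicWeight (dyadicIdx i x - dyadicIdx i t)) * W t ≤
        bracketMass * (ENNReal.ofReal (cubicWeight (dyadicIdx i x - ν)) *
          ‖g ((2 : ℝ) ^ (-i) * ν)‖ₑ + ENNReal.ofReal (cubicWeight (dyadicIdx i x - ν)) * A) := by
      intro ν
      rw [setLIntegral_congr_fun (g := fun t => ((‖g ((2 : ℝ) ^ (-i) * ν)‖ₑ + ‖g x‖ₑ) *
        ENNReal.ofReal (cubicWeight (dyadicIdx i x - ν))) * W t)
        (measurable_dyadicIdx i (measurableSet_singleton ν)), lintegral_const_mul _ hWm]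
      · calc _ ≤ ((‖g ((2 : ℝ) ^ (-i) * ν)‖ₑ + A) *
            ENNReal.ofReal (cubicWeight (dyadicIdx i x - ν))) * bracketMass := by
              rw [← hWint]
              gcongr
              · exact enorm_le_avgOp_step hgs x
              · exact Measure.restrict_le_self
          _ = _ := by ring
      · intro t ht
        have ht' : dyadicIdx i t = ν := ht
        show (‖g t‖ₑ + ‖g x‖ₑ) * _ * W t = _
        rw [ht', hgs.eq_comp t, ht']
    refine (ENNReal.tsum_le_tsum hfib).trans ?_
    rw [ENNReal.tsum_mul_left, ENNReal.tsum_add, ← avgOp_step hgs, ENNReal.tsum_mul_right]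
    rw [add_mul, one_mul]
    gcongr
    exact tsum_weight_le _
  rw [e1]
  refine (enorm_integral_le_lintegral_enorm _).trans ((lintegral_mono hpt).trans ?_)
  rw [lintegral_const_mul' _ _ ENNReal.ofReal_ne_top]
  refine (mul_le_mul_right hsum _).trans ?_
  have hb : bracketMass ≤ ENNReal.ofReal (bracketMass.toReal + 1) := by
    refine ENNReal.le_ofReal_iff_toReal_le hbM.ne (by positivity) |>.2 (by linarith)
  have hw := one_le_weightSum
  rw [ENNReal.ofReal_mul (p := 8 * C) (by positivity),
    ENNReal.ofReal_mul (p := 8 * C * (bracketMass.toReal + 1)) (by positivity),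
    ENNReal.ofReal_mul (p := 8 * C) (by positivity),
    ENNReal.ofReal_add zero_le_one (by linarith), ENNReal.ofReal_one]
  calc _ ≤ ENNReal.ofReal (8 * C) * ENNReal.ofReal (edgeWeight k i x) *
        (ENNReal.ofReal (bracketMass.toReal + 1) * ((1 + ENNReal.ofReal weightSum) * A)) := by
        gcongr
    _ = _ := by ring

theorem conv_haarProj (Φ : SchwartzMap ℝ ℂ) (k : ℕ) (E : Finset (ℕ × ℤ)) (g : ℝ → ℂ) (x : ℝ) :
    conv (haarProj E g) (lpKer Φ k) x = ∑ e ∈ E, (2 : ℂ) ^ e.1 * (∫ y, g y * haarFn e.1 e.2 y) *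
      conv (haarFn e.1 e.2) (lpKer Φ k) x := by
  unfold conv haarProj
  simp only [Finset.sum_mul]
  rw [integral_finsetSum]
  · refine Finset.sum_congr rfl fun e _ => ?_
    simp only [mul_assoc]
    rw [integral_const_mul, integral_const_mul]
  · intro e _
    simp only [mul_assoc]
    exact ((integrable_mul_lpKer Φ k (integrable_haarFn e.1 e.2) x).const_mul _).const_mul _

theorem sum_conv_lpKer (Φ : SchwartzMap ℝ ℂ) {f : ℝ → ℂ} (hf : Integrable f) (L : ℕ) (y : ℝ) :
    ∑ l ∈ Finset.range (L + 1), conv f (lpKer Φ l) y = conv f (dil Φ L) y := by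
  unfold conv
  rw [← integral_finsetSum _ fun l _ => integrable_mul_lpKer Φ l hf y]
  simp only [← Finset.mul_sum, sum_lpKer]

theorem conv_dil_eq (Φ : SchwartzMap ℝ ℂ) (f : ℝ → ℂ) (L : ℕ) (y : ℝ) :
    conv f (dil Φ L) y = ∫ v, f (y - ((2 : ℝ) ^ L)⁻¹ * v) * Φ v := by
  have h := Measure.integral_comp_mul_left
    (fun v => f (y - ((2 : ℝ) ^ L)⁻¹ * v) * Φ v) ((2 : ℝ) ^ L)
  have h2 : (2 : ℝ) ^ L ≠ 0 := by positivity
  simp only [inv_mul_cancel_left₀ h2] at h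
  unfold conv dil
  rw [← integral_sub_left_eq_self _ _ y]
  simp only [sub_sub_cancel, mul_left_comm (f _) ((2 : ℂ) ^ L)]
  rw [integral_const_mul, h, abs_of_pos (by positivity), Complex.real_smul, ← mul_assoc]
  push_cast
  rw [mul_inv_cancel₀ (pow_ne_zero _ two_ne_zero), one_mul]

theorem exists_schwartz_bound (f : SchwartzMap ℝ ℂ) : ∃ M, ∀ y, ‖f y‖ ≤ M := by
  obtain ⟨M, hM0, hM, -⟩ := exists_schwartz_decay f
  refine ⟨M, fun y => (hM y).trans (mul_le_of_le_one_right hM0.le ?_)⟩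
  exact inv_le_one_of_one_le₀ (one_le_pow₀ (by linarith [abs_nonneg y]))

theorem tendsto_conv_dil (Φ : SchwartzMap ℝ ℂ) (hΦ : ∫ y, Φ y = 1) (f : SchwartzMap ℝ ℂ) (y : ℝ) :
    Filter.Tendsto (fun L => conv f (dil Φ L) y) Filter.atTop (nhds (f y)) := by
  obtain ⟨M, hM⟩ := exists_schwartz_bound f
  simp only [conv_dil_eq]
  have h1 : f y = ∫ v, f y * Φ v := by rw [integral_const_mul, hΦ, mul_one]
  rw [h1]
  refine tendsto_integral_of_dominated_convergence (fun v => M * ‖Φ v‖) (fun L => ?_)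
    (Φ.integrable.norm.const_mul _) (fun L => Filter.Eventually.of_forall fun v => ?_)
    (Filter.Eventually.of_forall fun v => ?_)
  · exact ((f.continuous.comp (by fun_prop)).mul Φ.continuous).aestronglyMeasurable
  · rw [norm_mul]
    gcongr
    exact hM _
  · refine Filter.Tendsto.mul_const _ ((f.continuous.tendsto y).comp ?_)
    have h2 : Filter.Tendsto (fun L : ℕ => ((2 : ℝ) ^ L)⁻¹) Filter.atTop (nhds 0) :=
      (tendsto_pow_atTop_atTop_of_one_lt one_lt_two).inv_tendsto_atTop
    simpa using (h2.mul_const v).const_sub y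

theorem tendsto_integral_conv_dil (Φ : SchwartzMap ℝ ℂ) (hΦ : ∫ y, Φ y = 1) (f : SchwartzMap ℝ ℂ)
    (j : ℕ) (μ : ℤ) :
    Filter.Tendsto (fun L => ∫ y, conv f (dil Φ L) y * haarFn j μ y) Filter.atTop
      (nhds (∫ y, f y * haarFn j μ y)) := by
  obtain ⟨M, hM⟩ := exists_schwartz_bound f
  refine tendsto_integral_of_dominated_convergence
    (fun y => (∫ v, M * ‖Φ v‖) * ‖haarFn j μ y‖) (fun L => ?_)
    ((integrable_haarFn j μ).norm.const_mul _) (fun L => Filter.Eventually.of_forall fun y => ?_)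
    (Filter.Eventually.of_forall fun y => (tendsto_conv_dil Φ hΦ f y).mul_const _)
  · exact ((measurable_conv f.continuous.measurable (continuous_dil Φ L).measurable).mul
      (measurable_haarFn j μ)).aestronglyMeasurable
  · rw [norm_mul, conv_dil_eq]
    gcongr
    refine norm_integral_le_of_norm_le (Φ.integrable.norm.const_mul _)
      (Filter.Eventually.of_forall fun v => ?_)
    rw [norm_mul]
    gcongr
    exact hM _

/-- Littlewood-Paley decomposition of the input of a Haar projection. -/
theorem enorm_conv_haarProj_le (Φ : SchwartzMap ℝ ℂ) (hΦ : ∫ y, Φ y = 1) (f : SchwartzMap ℝ ℂ)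
    (E : Finset (ℕ × ℤ)) (k : ℕ) (x : ℝ) :
    ‖conv (haarProj E f) (lpKer Φ k) x‖ₑ ≤
      ∑' l : ℕ, ‖conv (haarProj E (conv f (lpKer Φ l))) (lpKer Φ k) x‖ₑ := by
  have hsum : ∀ L, ∑ l ∈ Finset.range (L + 1), conv (haarProj E (conv f (lpKer Φ l))) (lpKer Φ k) x =
      ∑ e ∈ E, (2 : ℂ) ^ e.1 * (∫ y, conv f (dil Φ L) y * haarFn e.1 e.2 y) *
        conv (haarFn e.1 e.2) (lpKer Φ k) x := by
    intro L
    simp only [conv_haarProj]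
    rw [Finset.sum_comm]
    refine Finset.sum_congr rfl fun e _ => ?_
    rw [← Finset.sum_mul, ← Finset.mul_sum, ← integral_finsetSum]
    · simp only [← Finset.sum_mul, sum_conv_lpKer Φ f.integrable]
    · intro l _
      exact (integrable_conv f.integrable (integrable_lpKer Φ l)).mul_bdd (c := 1)
        (measurable_haarFn _ _).aestronglyMeasurable
        (Filter.Eventually.of_forall fun t => norm_haarFn_le _ _ _)
  have hlim : Filter.Tendsto (fun L => ∑ l ∈ Finset.range (L + 1),
      conv (haarProj E (conv f (lpKer Φ l))) (lpKer Φ k) x) Filter.atTop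
      (nhds (conv (haarProj E f) (lpKer Φ k) x)) := by
    simp only [hsum]
    rw [conv_haarProj]
    refine tendsto_finsetSum _ fun e _ => ?_
    exact ((tendsto_integral_conv_dil Φ hΦ f e.1 e.2).const_mul _).mul_const _
  refine le_of_tendsto hlim.enorm (Filter.Eventually.of_forall fun L => ?_)
  exact (enorm_sum_le _ _).trans (ENNReal.sum_le_tsum _)

theorem conv_haarProj_eq_sum (Φ : SchwartzMap ℝ ℂ) (k : ℕ) (E : Finset (ℕ × ℤ)) (g : ℝ → ℂ)
    (x : ℝ) : conv (haarProj E g) (lpKer Φ k) x =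
      ∑ j ∈ HFset E, conv (levelProj E j g) (lpKer Φ k) x := by
  simp only [levelProj, conv_haarProj]
  exact (Finset.sum_fiberwise_of_maps_to (fun e he => Finset.mem_image_of_mem _ he) _).symm

theorem enorm_conv_haarProj_le_sum (Φ : SchwartzMap ℝ ℂ) (hΦ : ∫ y, Φ y = 1) (f : SchwartzMap ℝ ℂ)
    (E : Finset (ℕ × ℤ)) (k : ℕ) (x : ℝ) :
    ‖conv (haarProj E f) (lpKer Φ k) x‖ₑ ≤ ∑ j ∈ HFset E, ∑' l : ℕ,
      ‖conv (levelProj E j (conv f (lpKer Φ l))) (lpKer Φ k) x‖ₑ := by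
  rw [conv_haarProj_eq_sum]
  refine (enorm_sum_le _ _).trans (Finset.sum_le_sum fun j _ => ?_)
  exact enorm_conv_haarProj_le Φ hΦ f _ k x

/-- The Littlewood-Paley piece of `g` of index `k`, vanishing for negative `k`. -/
def lpPiece (Φ : ℝ → ℂ) (g : ℝ → ℂ) (k : ℤ) : ℝ → ℂ :=
  if 0 ≤ k then conv g (lpKer Φ k.toNat) else fun _ => 0

/-- The level `j` Haar projection of the Littlewood-Paley piece of index `l`. -/
def haarPiece (Φ : ℝ → ℂ) (E : Finset (ℕ × ℤ)) (f : ℝ → ℂ) (j l : ℤ) : ℝ → ℂ :=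
  if 0 ≤ j then levelProj E j.toNat (lpPiece Φ f l) else fun _ => 0

/-- The weighted family of Littlewood-Paley pieces entering the Triebel-Lizorkin norm. -/
def lpFamily (Φ : ℝ → ℂ) (s : ℝ) (g : ℝ → ℂ) (k : ℤ) (x : ℝ) : ℝ≥0∞ :=
  ENNReal.ofReal ((2 : ℝ) ^ ((k : ℝ) * s)) * ‖lpPiece Φ g k x‖ₑ

/-- The weighted family of Haar pieces with frequency shift `n`. -/
def haarFamily (Φ : ℝ → ℂ) (s : ℝ) (E : Finset (ℕ × ℤ)) (f : ℝ → ℂ) (n j : ℤ) (x : ℝ) : ℝ≥0∞ :=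
  ENNReal.ofReal ((2 : ℝ) ^ ((j : ℝ) * s)) * ‖haarPiece Φ E f j (j + n) x‖ₑ

theorem lpPiece_natCast (Φ g : ℝ → ℂ) (k : ℕ) : lpPiece Φ g k = conv g (lpKer Φ k) := by
  simp [lpPiece]

theorem lpPiece_of_neg (Φ g : ℝ → ℂ) {k : ℤ} (hk : k < 0) : lpPiece Φ g k = fun _ => 0 := by
  simp [lpPiece, not_le.2 hk]

theorem haarPiece_natCast (Φ : ℝ → ℂ) (E : Finset (ℕ × ℤ)) (f : ℝ → ℂ) (j : ℕ) (l : ℤ) :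
    haarPiece Φ E f j l = levelProj E j (lpPiece Φ f l) := by
  simp [haarPiece]

theorem haarPiece_of_neg (Φ : ℝ → ℂ) (E : Finset (ℕ × ℤ)) (f : ℝ → ℂ) {j : ℤ} (hj : j < 0)
    (l : ℤ) : haarPiece Φ E f j l = fun _ => 0 := by
  simp [haarPiece, not_le.2 hj]

theorem levelProj_zero (E : Finset (ℕ × ℤ)) (j : ℕ) : levelProj E j (fun _ => 0) = fun _ => 0 := by
  funext x; simp [levelProj, haarProj]

theorem lpPiece_zero (Φ : ℝ → ℂ) (k : ℤ) : lpPiece Φ (fun _ => 0) k = fun _ => 0 := by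
  unfold lpPiece conv; simp

theorem measurable_lpPiece (Φ : SchwartzMap ℝ ℂ) {g : ℝ → ℂ} (hg : Measurable g) (k : ℤ) :
    Measurable (lpPiece Φ g k) := by
  unfold lpPiece
  split_ifs
  · exact measurable_conv hg (continuous_lpKer Φ _).measurable
  · exact measurable_const

theorem isDyadicStep_haarPiece (Φ : ℝ → ℂ) (E : Finset (ℕ × ℤ)) (f : ℝ → ℂ) (j l : ℤ) :
    IsDyadicStep (j + 1) (haarPiece Φ E f j l) := by
  rcases le_or_gt 0 j with hj | hj
  · obtain ⟨j, rfl⟩ := Int.eq_ofNat_of_zero_le hj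
    rw [haarPiece_natCast]
    exact isDyadicStep_levelProj E j _
  · rw [haarPiece_of_neg _ _ _ hj]
    exact fun _ _ _ => rfl

theorem integrable_haarPiece (Φ : ℝ → ℂ) (E : Finset (ℕ × ℤ)) (f : ℝ → ℂ) (j l : ℤ) :
    Integrable (haarPiece Φ E f j l) := by
  unfold haarPiece
  split_ifs
  · exact integrable_haarProj _ _
  · exact integrable_zero _ _ _

theorem haarPiece_eq_zero (Φ : ℝ → ℂ) (E : Finset (ℕ × ℤ)) (f : ℝ → ℂ) {j : ℤ}
    (hj : j ∉ (HFset E).map Nat.castEmbedding) (l : ℤ) (x : ℝ) : haarPiece Φ E f j l x = 0 := by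
  rcases le_or_gt 0 j with h | h
  · obtain ⟨j, rfl⟩ := Int.eq_ofNat_of_zero_le h
    rw [haarPiece_natCast]
    exact levelProj_eq_zero (fun hm => hj (Finset.mem_map_of_mem Nat.castEmbedding hm)) _ _
  · rw [haarPiece_of_neg _ _ _ h]

theorem measurable_lpFamily (Φ : SchwartzMap ℝ ℂ) (s : ℝ) {g : ℝ → ℂ} (hg : Measurable g) (k : ℤ) :
    Measurable (lpFamily Φ s g k) :=
  (measurable_lpPiece Φ hg k).enorm.const_mul _

theorem measurable_haarFamily (Φ : ℝ → ℂ) (s : ℝ) (E : Finset (ℕ × ℤ)) (f : ℝ → ℂ) (n j : ℤ) :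
    Measurable (haarFamily Φ s E f n j) :=
  (isDyadicStep_haarPiece Φ E f j _).measurable.enorm.const_mul _

theorem FNorm_eq_mixedNorm {φ₀ : ℝ → ℂ} {Φ : ℝ → ℂ}
    (hΦ : ∀ k g, LPop φ₀ k g = conv g (lpKer Φ k)) {p q : ℝ} (hq : 0 < q) (s : ℝ) (g : ℝ → ℂ) :
    FNorm φ₀ p q s g = mixedNorm p q (lpFamily Φ s g) := by
  unfold FNorm mixedNorm
  congr 1
  refine lintegral_congr fun x => ?_
  congr 1
  have hsupp : Function.support (fun k : ℤ => lpFamily Φ s g k x ^ q) ⊆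
      Set.range (Nat.cast : ℕ → ℤ) := by
    intro k hk
    rcases le_or_gt 0 k with h | h
    · obtain ⟨n, rfl⟩ := Int.eq_ofNat_of_zero_le h
      exact ⟨n, rfl⟩
    · exact absurd (by simp [lpFamily, lpPiece_of_neg _ _ h, hq]) hk
  rw [← Nat.cast_injective.tsum_eq hsupp]
  refine tsum_congr fun k => ?_
  rw [lpFamily, lpPiece_natCast, ENNReal.mul_rpow_of_nonneg _ _ hq.le, hΦ, ofReal_norm,
    ENNReal.ofReal_rpow_of_pos (by positivity), ← Real.rpow_mul (by norm_num)]
  rfl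

theorem lpFamily_haarProj_le (Φ : SchwartzMap ℝ ℂ) (hΦ : ∫ y, Φ y = 1) (f : SchwartzMap ℝ ℂ)
    (E : Finset (ℕ × ℤ)) (s : ℝ) (k : ℤ) (x : ℝ) :
    lpFamily Φ s (haarProj E f) k x ≤
      ∑' j : ℤ, ∑' l : ℤ, lpFamily Φ s (haarPiece Φ E f j l) k x := by
  rcases le_or_gt 0 k with h | h
  · obtain ⟨k, rfl⟩ := Int.eq_ofNat_of_zero_le h
    simp only [lpFamily, ENNReal.tsum_mul_left, lpPiece_natCast]
    gcongr
    refine (enorm_conv_haarProj_le_sum Φ hΦ f E k x).trans ((ENNReal.sum_le_tsum _).trans ?_)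
    refine le_trans (ENNReal.tsum_le_tsum fun j => ?_) (ENNReal.tsum_comp_le_tsum_of_injective
      (Nat.cast_injective (R := ℤ)) _)
    refine le_trans (ENNReal.tsum_le_tsum fun l => ?_) (ENNReal.tsum_comp_le_tsum_of_injective
      (Nat.cast_injective (R := ℤ)) _)
    simp only [haarPiece_natCast, lpPiece_natCast]
    exact le_rfl
  · simp [lpFamily, lpPiece_of_neg _ _ h]

/-- Frequency decay `min (1, 2 ^ n)` of the Haar coefficients, in all ranges. -/
theorem enorm_haarPiece_le (Φ : SchwartzMap ℝ ℂ)
    (hΦ : ∀ a b : ℕ, b < a → ∀ x, ∫ t, dil Φ b t * dil Φ a (x - t) = dil Φ b x) :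
    ∃ C : ℝ, 0 < C ∧ ∀ (E : Finset (ℕ × ℤ)) (f : SchwartzMap ℝ ℂ) (j n : ℤ) (x : ℝ),
      ‖haarPiece Φ E f j (j + n) x‖ₑ ≤ ENNReal.ofReal (C * 2 ^ ((min n 0 : ℤ) : ℝ)) *
        avgOp (j + min n 0) (fun y => ‖lpPiece Φ f (j + n) y‖ₑ) x := by
  obtain ⟨C, hC0, hC⟩ := enorm_levelProj_conv_le Φ hΦ
  refine ⟨C + 1, by positivity, fun E f j n x => ?_⟩
  rcases lt_or_ge j 0 with hj | hj
  · simp [haarPiece_of_neg _ _ _ hj]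
  obtain ⟨j, rfl⟩ := Int.eq_ofNat_of_zero_le hj
  rw [haarPiece_natCast]
  rcases le_or_gt 0 n with hn | hn
  · rw [min_eq_right hn, add_zero]
    refine (enorm_levelProj_le E j _ x).trans (le_mul_of_one_le_left zero_le ?_)
    rw [ENNReal.one_le_ofReal]
    simp [hC0.le]
  · rw [min_eq_left hn.le]
    rcases lt_or_ge ((j : ℤ) + n) 0 with hl | hl
    · simp [lpPiece_of_neg _ _ hl, levelProj_zero]
    obtain ⟨l, hl'⟩ := Int.eq_ofNat_of_zero_le hl
    rw [hl', lpPiece_natCast]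
    refine (hC E j l (by lia) f f.continuous.measurable f.integrable x).trans ?_
    have e : (2 : ℝ) ^ l * 2 ^ (-(j : ℤ)) = 2 ^ (n : ℝ) := by
      rw [← zpow_natCast, ← zpow_add₀ (by norm_num), Real.rpow_intCast, ← hl']
      congr 1
      ring
    rw [e]
    gcongr
    linarith

theorem mixedNorm_const_mul_avgOp_le {p q : ℝ} (hp : 1 < p) (hpq : p < q) :
    ∃ C : ℝ, 0 < C ∧ ∀ (b : ℝ≥0∞) (σ : ℤ → ℤ) (g h : ℤ → ℝ → ℝ≥0∞), (∀ k, Measurable (g k)) →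
      (∀ k x, h k x ≤ b * avgOp (σ k) (g k) x) →
      mixedNorm p q h ≤ b * ENNReal.ofReal C * mixedNorm p q g := by
  obtain ⟨C, hC⟩ := mixedNorm_avgOp_le hp hpq
  have hp0 : 0 < p := by linarith
  have hq0 : 0 < q := by linarith
  refine ⟨C + 1, by positivity, fun b σ g h hg hh => ?_⟩
  refine (mixedNorm_mono hp0 hq0 hh).trans ?_
  rw [mixedNorm_const_mul hp0 hq0 (fun k => measurable_avgOp _ (hg k)), mul_assoc]
  gcongr
  refine (hC σ g hg).trans ?_
  gcongr
  rw [← ENNReal.ofReal_coe_nnreal]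
  exact ENNReal.ofReal_le_ofReal (by linarith)

theorem ofReal_two_rpow_mul {a b c s C : ℝ} (h : a + b = c) (hC : 0 ≤ C) :
    ENNReal.ofReal ((2 : ℝ) ^ (c * s)) * ENNReal.ofReal C =
      ENNReal.ofReal (C * 2 ^ (a * s)) * ENNReal.ofReal (2 ^ (b * s)) := by
  rw [← ENNReal.ofReal_mul (by positivity), ← ENNReal.ofReal_mul (by positivity), mul_assoc,
    ← Real.rpow_add (by norm_num), ← add_mul, h, mul_comm]

theorem two_rpow_min_mul_le {s : ℝ} (n : ℤ) :
    (2 : ℝ) ^ ((min n 0 : ℤ) : ℝ) * 2 ^ (-(n : ℝ) * s) ≤ 2 ^ (-(min s (1 - s)) * |(n : ℝ)|) := by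
  rw [← Real.rpow_add (by norm_num)]
  refine Real.rpow_le_rpow_of_exponent_le one_le_two ?_
  rcases le_or_gt 0 n with hn | hn
  · have hn' : (0 : ℝ) ≤ n := by exact_mod_cast hn
    rw [min_eq_right hn, abs_of_nonneg hn']
    have := min_le_left s (1 - s)
    push_cast
    nlinarith
  · have hn' : (n : ℝ) < 0 := by exact_mod_cast hn
    rw [min_eq_left hn.le, abs_of_neg hn']
    have := min_le_right s (1 - s)
    nlinarith

theorem mixedNorm_haarFamily_le (Φ : SchwartzMap ℝ ℂ)
    (hΦ : ∀ a b : ℕ, b < a → ∀ x, ∫ t, dil Φ b t * dil Φ a (x - t) = dil Φ b x)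
    {p q : ℝ} (hp : 1 < p) (hpq : p < q) (s : ℝ) :
    ∃ C : ℝ, 0 < C ∧ ∀ (E : Finset (ℕ × ℤ)) (f : SchwartzMap ℝ ℂ) (n : ℤ),
      mixedNorm p q (haarFamily Φ s E f n) ≤
        ENNReal.ofReal (C * 2 ^ (-(min s (1 - s)) * |(n : ℝ)|)) *
          mixedNorm p q (lpFamily Φ s f) := by
  obtain ⟨C, hC0, hC⟩ := enorm_haarPiece_le Φ hΦ
  obtain ⟨D, hD0, hD⟩ := mixedNorm_const_mul_avgOp_le hp hpq
  refine ⟨C * D, by positivity, fun E f n => ?_⟩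
  have hm := measurable_lpFamily Φ s f.continuous.measurable
  have h := hD (ENNReal.ofReal (C * 2 ^ ((min n 0 : ℤ) : ℝ) * 2 ^ (-(n : ℝ) * s)))
    (fun j => j + min n 0) (fun j => lpFamily Φ s f (j + n)) (haarFamily Φ s E f n)
    (fun j => hm _) (fun j x => ?_)
  · refine h.trans ?_
    rw [mixedNorm_shift (lpFamily Φ s f) n, ← ENNReal.ofReal_mul (by positivity)]
    refine mul_le_mul_left (ENNReal.ofReal_le_ofReal ?_) _
    have := two_rpow_min_mul_le (s := s) n
    calc _ = C * D * ((2 : ℝ) ^ ((min n 0 : ℤ) : ℝ) * 2 ^ (-(n : ℝ) * s)) := by ring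
      _ ≤ _ := by gcongr
  · unfold haarFamily lpFamily
    rw [avgOp_const_mul _ (measurable_lpPiece Φ f.continuous.measurable _).enorm, ← mul_assoc,
      ← ofReal_two_rpow_mul (a := -(n : ℝ)) (c := j) (by push_cast; ring) (by positivity)]
    exact (mul_le_mul_right (hC E f j n x) _).trans (le_of_eq (mul_assoc _ _ _).symm)

theorem lpFamily_haarPiece_low_le (Φ : SchwartzMap ℝ ℂ) (s : ℝ) :
    ∃ C : ℝ, 0 < C ∧ ∀ (E : Finset (ℕ × ℤ)) (f : ℝ → ℂ) (j m n : ℤ) (x : ℝ),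
      lpFamily Φ s (haarPiece Φ E f j (j + n)) (j + m) x ≤ ENNReal.ofReal (C * 2 ^ (m * s)) *
        avgOp (j + m) (haarFamily Φ s E f n j) x := by
  obtain ⟨C, hC0, hC⟩ := enorm_conv_lpKer_le Φ
  refine ⟨C, hC0, fun E f j m n x => ?_⟩
  have hmeas := (isDyadicStep_haarPiece Φ E f j (j + n)).measurable
  unfold lpFamily haarFamily
  rw [avgOp_const_mul _ hmeas.enorm]
  rcases lt_or_ge (j + m) 0 with hk | hk
  · simp [lpPiece_of_neg _ _ hk]
  obtain ⟨k, hk'⟩ := Int.eq_ofNat_of_zero_le hk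
  rw [hk', lpPiece_natCast]
  refine (mul_le_mul_right (hC k _ hmeas x) _).trans (le_of_eq ?_)
  rw [← mul_assoc, ← mul_assoc,
    ofReal_two_rpow_mul (a := m) (b := j) (by rw [← hk']; push_cast; ring) hC0.le]

theorem lpFamily_haarPiece_high_le (Φ : SchwartzMap ℝ ℂ) (s : ℝ) :
    ∃ C : ℝ, 0 < C ∧ ∀ (E : Finset (ℕ × ℤ)) (f : ℝ → ℂ) (j m n : ℤ) (x : ℝ), 1 ≤ m →
      lpFamily Φ s (haarPiece Φ E f j (j + n)) (j + m) x ≤ ENNReal.ofReal (C * 2 ^ (m * s)) *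
        (ENNReal.ofReal (edgeWeight (j + m) (j + 1) x) *
          avgOp (j + 1) (haarFamily Φ s E f n j) x) := by
  obtain ⟨C, hC0, hC⟩ := enorm_conv_step_le Φ
  refine ⟨C, hC0, fun E f j m n x hm => ?_⟩
  have hstep := isDyadicStep_haarPiece Φ E f j (j + n)
  rcases lt_or_ge j 0 with hj | hj
  · simp [lpFamily, haarPiece_of_neg _ _ _ hj, lpPiece_zero]
  unfold lpFamily haarFamily
  rw [avgOp_const_mul _ hstep.measurable.enorm]
  obtain ⟨k, hk'⟩ := Int.eq_ofNat_of_zero_le (show 0 ≤ j + m by lia)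
  rw [hk', lpPiece_natCast]
  refine (mul_le_mul_right (hC k (j + 1) (by lia) (by lia) _ (integrable_haarPiece Φ E f j _)
    hstep x) _).trans (le_of_eq ?_)
  rw [mul_left_comm (ENNReal.ofReal (edgeWeight _ _ _)) (ENNReal.ofReal _), ← mul_assoc,
    ← mul_assoc, ofReal_two_rpow_mul (a := m) (b := j) (by rw [← hk']; push_cast; ring) hC0.le]
  simp only [mul_assoc]

/-- Gain from the concentration of high frequencies near the jumps. -/
theorem mixedNorm_edgeWeight_le {p q : ℝ} (hp : 1 < p) (hpq : p < q) :
    ∃ C : ℝ, 0 < C ∧ ∀ (m : ℤ) (B : Finset ℤ) (g : ℤ → ℝ → ℝ≥0∞),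
      (∀ j, IsDyadicStep (j + 1) (g j)) → (∀ j ∉ B, ∀ x, g j x = 0) →
      mixedNorm p q (fun j x => ENNReal.ofReal (edgeWeight (j + m) (j + 1) x) * g j x) ≤
        ENNReal.ofReal (C * 2 ^ (-(m : ℝ) / q)) * mixedNorm p q g ∧
      mixedNorm p q (fun j x => ENNReal.ofReal (edgeWeight (j + m) (j + 1) x) * g j x) ≤
        ENNReal.ofReal (C * (2 ^ (-(m : ℝ) / p) * (B.card : ℝ) ^ (1 / p - 1 / q))) *
          mixedNorm p q g := by
  have hp0 : 0 < p := by linarith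
  have hq0 : 0 < q := by linarith
  have hbM := bracketMass_lt_top
  set K : ℝ := 2 * (2 * bracketMass.toReal + 1) with hK
  have hK0 : 0 < K := by positivity
  refine ⟨(K / (p / q)) ^ (1 / q) + K ^ (1 / p), by positivity, fun m B g hg hgB => ?_⟩
  set c : ℝ≥0∞ := ENNReal.ofReal (K * 2 ^ (-(m : ℝ))) with hc
  have hc0 : c ≠ 0 := by
    rw [hc]; exact (ENNReal.ofReal_pos.2 (by positivity)).ne'
  have hu : ∀ j, Measurable fun x => ENNReal.ofReal (edgeWeight (j + m) (j + 1) x) := fun j =>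
    (measurable_edgeWeight _ _).ennreal_ofReal
  have hu1 : ∀ j x, ENNReal.ofReal (edgeWeight (j + m) (j + 1) x) ≤ 1 := fun j x =>
    ENNReal.ofReal_le_one.2 (edgeWeight_le_one _ _ _)
  have huc : ∀ j ν : ℤ, ∫⁻ x in dyadicIdx (j + 1) ⁻¹' {ν},
      ENNReal.ofReal (edgeWeight (j + m) (j + 1) x) ≤ c * ENNReal.ofReal (2 ^ (-(j + 1))) := by
    intro j ν
    refine (lintegral_edgeWeight_le (j + m) (j + 1) ν).trans (mul_le_mul_left ?_ _)
    have e : (2 : ℝ) ^ (j + 1 - (j + m)) = 2 * 2 ^ (-(m : ℝ)) := by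
      rw [show j + 1 - (j + m) = 1 + -m by ring, zpow_add₀ (by norm_num), zpow_one,
        ← Real.rpow_intCast]
      push_cast
      rfl
    have hb : (2 * bracketMass) = ENNReal.ofReal (2 * bracketMass.toReal) := by
      rw [ENNReal.ofReal_mul (by norm_num), ENNReal.ofReal_toReal hbM.ne]; simp
    rw [e, hb, ← ENNReal.ofReal_mul (by positivity), hc, hK]
    refine ENNReal.ofReal_le_ofReal ?_
    have : (0 : ℝ) < 2 ^ (-(m : ℝ)) := by positivity
    nlinarith
  constructor
  · refine (mixedNorm_damped_le hp hpq hg hgB hu hu1 hc0 ENNReal.ofReal_ne_top huc).trans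
      (mul_le_mul_left ?_ _)
    rw [hc, ← ENNReal.ofReal_div_of_pos (by positivity), ENNReal.ofReal_rpow_of_pos (by positivity)]
    refine ENNReal.ofReal_le_ofReal ?_
    rw [mul_div_right_comm, Real.mul_rpow (by positivity) (by positivity),
      ← Real.rpow_mul (by norm_num), mul_one_div]
    gcongr
    linarith [Real.rpow_nonneg hK0.le (1 / p)]
  · refine (mixedNorm_damped_le_card hp hpq hg hgB hu hu1 huc).trans (mul_le_mul_left ?_ _)
    have hexp : 0 ≤ 1 / p - 1 / q := by
      rw [sub_nonneg]; exact one_div_le_one_div_of_le hp0 hpq.le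
    rw [hc, ENNReal.ofReal_rpow_of_pos (by positivity), ← ENNReal.ofReal_natCast,
      ENNReal.ofReal_rpow_of_nonneg (by positivity) hexp, ← ENNReal.ofReal_mul (by positivity)]
    refine ENNReal.ofReal_le_ofReal ?_
    rw [Real.mul_rpow (by positivity) (by positivity),
      ← Real.rpow_mul (by norm_num), mul_one_div, mul_assoc]
    gcongr
    have : 0 ≤ (K / (p / q)) ^ (1 / q) := by positivity
    linarith

theorem mixedNorm_diagonal_low_le (Φ : SchwartzMap ℝ ℂ) {p q : ℝ} (hp : 1 < p) (hpq : p < q)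
    (s : ℝ) : ∃ C : ℝ, 0 < C ∧ ∀ (E : Finset (ℕ × ℤ)) (f : ℝ → ℂ) (m n : ℤ),
      mixedNorm p q (fun j => lpFamily Φ s (haarPiece Φ E f j (j + n)) (j + m)) ≤
        ENNReal.ofReal (C * 2 ^ (m * s)) * mixedNorm p q (haarFamily Φ s E f n) := by
  obtain ⟨C, hC0, hC⟩ := lpFamily_haarPiece_low_le Φ s
  obtain ⟨D, hD0, hD⟩ := mixedNorm_const_mul_avgOp_le hp hpq
  refine ⟨C * D, by positivity, fun E f m n => ?_⟩
  refine (hD _ (fun j => j + m) _ _ (measurable_haarFamily Φ s E f n)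
    (fun j x => hC E f j m n x)).trans (le_of_eq ?_)
  rw [← ENNReal.ofReal_mul (by positivity), mul_right_comm]

theorem mixedNorm_diagonal_high_le (Φ : SchwartzMap ℝ ℂ) {p q : ℝ} (hp : 1 < p) (hpq : p < q)
    (s : ℝ) : ∃ C : ℝ, 0 < C ∧ ∀ (E : Finset (ℕ × ℤ)) (f : ℝ → ℂ) (m n : ℤ), 1 ≤ m →
      mixedNorm p q (fun j => lpFamily Φ s (haarPiece Φ E f j (j + n)) (j + m)) ≤
        ENNReal.ofReal (C * (2 ^ (m * s) * min (2 ^ (-(m : ℝ) / q))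
          (2 ^ (-(m : ℝ) / p) * ((HFset E).card : ℝ) ^ (1 / p - 1 / q)))) *
          mixedNorm p q (haarFamily Φ s E f n) := by
  obtain ⟨C, hC0, hC⟩ := lpFamily_haarPiece_high_le Φ s
  obtain ⟨D, hD0, hD⟩ := mixedNorm_const_mul_avgOp_le hp hpq
  obtain ⟨K, hK0, hK⟩ := mixedNorm_edgeWeight_le hp hpq
  have hp0 : 0 < p := by linarith
  have hq0 : 0 < q := by linarith
  refine ⟨C * K * D, by positivity, fun E f m n hm => ?_⟩
  have hmeas := measurable_haarFamily Φ s E f n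
  have hA := hD 1 (fun j => j + 1) (haarFamily Φ s E f n)
    (fun j => avgOp (j + 1) (haarFamily Φ s E f n j)) hmeas (fun j x => by rw [one_mul])
  rw [one_mul] at hA
  obtain ⟨h1, h2⟩ := hK m ((HFset E).map Nat.castEmbedding)
    (fun j => avgOp (j + 1) (haarFamily Φ s E f n j))
    (fun j x y hxy => avgOp_congr_idx _ _ hxy) (fun j hj x => by
      have : haarFamily Φ s E f n j = fun _ => 0 := by
        funext y; simp [haarFamily, haarPiece_eq_zero Φ E f hj]
      simp [this, avgOp])
  rw [Finset.card_map] at h2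
  have hmono := mixedNorm_mono hp0 hq0 (fun j x => hC E f j m n x hm)
  rw [mixedNorm_const_mul hp0 hq0 (g := fun j x => ENNReal.ofReal (edgeWeight (j + m) (j + 1) x) *
    avgOp (j + 1) (haarFamily Φ s E f n j) x) (fun j => (measurable_edgeWeight _ _).ennreal_ofReal.mul
    (measurable_avgOp _ (hmeas j)))] at hmono
  have key : ∀ r : ℝ, 0 ≤ r → mixedNorm p q (fun j x =>
      ENNReal.ofReal (edgeWeight (j + m) (j + 1) x) *
        avgOp (j + 1) (haarFamily Φ s E f n j) x) ≤ ENNReal.ofReal (K * r) * mixedNorm p q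
          (fun j => avgOp (j + 1) (haarFamily Φ s E f n j)) →
      mixedNorm p q (fun j => lpFamily Φ s (haarPiece Φ E f j (j + n)) (j + m)) ≤
        ENNReal.ofReal (C * K * D * (2 ^ (m * s) * r)) *
          mixedNorm p q (haarFamily Φ s E f n) := by
    intro r hr h
    refine hmono.trans ((mul_le_mul_right (h.trans (mul_le_mul_right hA _)) _).trans (le_of_eq ?_))
    rw [← mul_assoc, ← mul_assoc, ← ENNReal.ofReal_mul (by positivity),
      ← ENNReal.ofReal_mul (by positivity)]
    congr 2
    ring
  rcases min_choice ((2 : ℝ) ^ (-(m : ℝ) / q))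
    (2 ^ (-(m : ℝ) / p) * ((HFset E).card : ℝ) ^ (1 / p - 1 / q)) with h | h
  · rw [h]; exact key _ (by positivity) h1
  · rw [h]; exact key _ (by positivity) h2

theorem two_rpow_mul_min_le {p q s : ℝ} (hs1 : 1 / q < s) (hs2 : s < 1 / p) {N : ℕ}
    (hN : 1 ≤ N) {a : ℤ} (ha : (N : ℝ) ≤ 2 ^ (a : ℝ)) (ha2 : (2 : ℝ) ^ (a : ℝ) ≤ 2 * N) (m : ℤ) :
    (2 : ℝ) ^ (m * s) * min (2 ^ (-(m : ℝ) / q))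
        (2 ^ (-(m : ℝ) / p) * (N : ℝ) ^ (1 / p - 1 / q)) ≤
      2 ^ (s - 1 / q) * ((N : ℝ) ^ (s - 1 / q) *
        2 ^ (-(min (s - 1 / q) (1 / p - s)) * |((m - a : ℤ) : ℝ)|)) := by
  have hN0 : (0 : ℝ) < N := by exact_mod_cast hN
  have hθ : 0 < s - 1 / q := by linarith
  have hδ : 0 < 1 / p - s := by linarith
  rcases le_or_gt m a with h | h
  · have h' : (m : ℝ) ≤ a := by exact_mod_cast h
    calc _ ≤ (2 : ℝ) ^ (m * s) * 2 ^ (-(m : ℝ) / q) := by gcongr; exact min_le_left _ _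
      _ = (2 ^ (a : ℝ)) ^ (s - 1 / q) * 2 ^ ((m - a) * (s - 1 / q)) := by
        rw [← Real.rpow_mul (by norm_num), ← Real.rpow_add (by norm_num),
          ← Real.rpow_add (by norm_num)]
        congr 1; ring
      _ ≤ (2 * N) ^ (s - 1 / q) *
          2 ^ (-(min (s - 1 / q) (1 / p - s)) * |((m - a : ℤ) : ℝ)|) := by
        gcongr ?_ ^ _ * ?_
        · refine Real.rpow_le_rpow_of_exponent_le one_le_two ?_
          push_cast
          rw [abs_of_nonpos (by linarith)]
          nlinarith [min_le_left (s - 1 / q) (1 / p - s)]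
      _ = _ := by rw [Real.mul_rpow (by norm_num) hN0.le, mul_assoc]
  · have h' : (a : ℝ) < m := by exact_mod_cast h
    have h2 : (1 : ℝ) ≤ 2 ^ (s - 1 / q) := Real.one_le_rpow one_le_two hθ.le
    calc _ ≤ (2 : ℝ) ^ (m * s) * (2 ^ (-(m : ℝ) / p) * (N : ℝ) ^ (1 / p - 1 / q)) := by
          gcongr; exact min_le_right _ _
      _ = (2 ^ (a : ℝ)) ^ (-(1 / p - s)) * (N : ℝ) ^ (1 / p - 1 / q) *
          2 ^ (-(m - a) * (1 / p - s)) := by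
        rw [← Real.rpow_mul (by norm_num), ← mul_assoc, mul_right_comm _ ((N : ℝ) ^ _),
          ← Real.rpow_add (by norm_num), ← Real.rpow_add (by norm_num)]
        congr 2; ring
      _ ≤ (N : ℝ) ^ (-(1 / p - s)) * (N : ℝ) ^ (1 / p - 1 / q) *
          2 ^ (-(min (s - 1 / q) (1 / p - s)) * |((m - a : ℤ) : ℝ)|) := by
        gcongr ?_ * _ * ?_
        · exact Real.rpow_le_rpow_of_nonpos hN0 ha (by linarith)
        · refine Real.rpow_le_rpow_of_exponent_le one_le_two ?_
          push_cast
          rw [abs_of_pos (by linarith)]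
          nlinarith [min_le_right (s - 1 / q) (1 / p - s)]
      _ = 1 * ((N : ℝ) ^ (s - 1 / q) *
          2 ^ (-(min (s - 1 / q) (1 / p - s)) * |((m - a : ℤ) : ℝ)|)) := by
        rw [← Real.rpow_add hN0, one_mul]
        congr 2; ring
      _ ≤ _ := by gcongr

theorem exists_two_rpow_between {N : ℕ} (hN : 1 ≤ N) :
    ∃ a : ℤ, (N : ℝ) ≤ 2 ^ (a : ℝ) ∧ (2 : ℝ) ^ (a : ℝ) ≤ 2 * N := by
  have hN0 : (0 : ℝ) < N := by exact_mod_cast hN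
  obtain ⟨n, h1, h2⟩ := exists_nat_pow_near (x := (N : ℝ)) (y := 2) (by exact_mod_cast hN)
    one_lt_two
  refine ⟨n + 1, ?_, ?_⟩
  · rw [Real.rpow_intCast]
    exact_mod_cast h2.le
  · rw [Real.rpow_intCast, zpow_add₀ (by norm_num), zpow_natCast, zpow_one]
    linarith

/-- All diagonal pieces, with a summable bound of total size `N ^ (s - 1 / q)`. -/
theorem mixedNorm_diagonal_piece_le (Φ : SchwartzMap ℝ ℂ)
    (hΦ : ∀ a b : ℕ, b < a → ∀ x, ∫ t, dil Φ b t * dil Φ a (x - t) = dil Φ b x)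
    {p q s : ℝ} (hp : 1 < p) (hpq : p < q) (hs1 : 1 / q < s) (hs2 : s < 1 / p) :
    ∃ C : ℝ, 0 < C ∧ ∀ (E : Finset (ℕ × ℤ)), E.Nonempty → ∃ a : ℤ, ∀ (f : SchwartzMap ℝ ℂ)
      (m n : ℤ), mixedNorm p q (fun j => lpFamily Φ s (haarPiece Φ E f j (j + n)) (j + m)) ≤
        ENNReal.ofReal (C * ((HFset E).card : ℝ) ^ (s - 1 / q)) * mixedNorm p q (lpFamily Φ s f) *
          ((ENNReal.ofReal (2 ^ (-s * |((m - 0 : ℤ) : ℝ)|)) +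
            ENNReal.ofReal (2 ^ (-(min (s - 1 / q) (1 / p - s)) * |((m - a : ℤ) : ℝ)|))) *
              ENNReal.ofReal (2 ^ (-(min s (1 - s)) * |((n - 0 : ℤ) : ℝ)|))) := by
  obtain ⟨C₁, hC₁0, hC₁⟩ := mixedNorm_diagonal_low_le Φ hp hpq s
  obtain ⟨C₂, hC₂0, hC₂⟩ := mixedNorm_diagonal_high_le Φ hp hpq s
  obtain ⟨D, hD0, hD⟩ := mixedNorm_haarFamily_le Φ hΦ hp hpq s
  refine ⟨(C₁ + C₂ * 2 ^ (s - 1 / q)) * D, by positivity, fun E hE => ?_⟩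
  have hN : 1 ≤ (HFset E).card := Finset.card_pos.2 (hE.image _)
  set N := (HFset E).card with hNdef
  have hN1 : (1 : ℝ) ≤ N := by exact_mod_cast hN
  obtain ⟨a, ha, ha2⟩ := exists_two_rpow_between hN
  refine ⟨a, fun f m n => ?_⟩
  set w₁ : ℝ := 2 ^ (-s * |((m - 0 : ℤ) : ℝ)|) with hw₁
  set w₂ : ℝ := 2 ^ (-(min (s - 1 / q) (1 / p - s)) * |((m - a : ℤ) : ℝ)|) with hw₂
  set w₃ : ℝ := 2 ^ (-(min s (1 - s)) * |((n - 0 : ℤ) : ℝ)|) with hw₃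
  have hw₁0 : 0 < w₁ := by positivity
  have hw₂0 : 0 < w₂ := by positivity
  have hw₃0 : 0 < w₃ := by positivity
  have hNθ : 1 ≤ (N : ℝ) ^ (s - 1 / q) := Real.one_le_rpow hN1 (by linarith)
  have h1 : mixedNorm p q (fun j => lpFamily Φ s (haarPiece Φ E f j (j + n)) (j + m)) ≤
      ENNReal.ofReal ((C₁ + C₂ * 2 ^ (s - 1 / q)) * (N : ℝ) ^ (s - 1 / q) * (w₁ + w₂)) *
        mixedNorm p q (haarFamily Φ s E f n) := by
    rcases le_or_gt m 0 with hm | hm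
    · refine (hC₁ E f m n).trans (mul_le_mul_left (ENNReal.ofReal_le_ofReal ?_) _)
      have hm' : (m : ℝ) ≤ 0 := by exact_mod_cast hm
      have e : (2 : ℝ) ^ (m * s) = w₁ := by
        rw [hw₁, sub_zero, abs_of_nonpos hm']; congr 1; ring
      rw [e]
      calc C₁ * w₁ = C₁ * 1 * w₁ := by ring
        _ ≤ _ := by
          gcongr
          · linarith [show 0 < C₂ * 2 ^ (s - 1 / q) by positivity]
          · linarith
    · refine (hC₂ E f m n hm).trans (mul_le_mul_left (ENNReal.ofReal_le_ofReal ?_) _)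
      calc _ ≤ C₂ * (2 ^ (s - 1 / q) * ((N : ℝ) ^ (s - 1 / q) * w₂)) := by
            exact mul_le_mul_of_nonneg_left (two_rpow_mul_min_le hs1 hs2 hN ha ha2 m) hC₂0.le
        _ = C₂ * 2 ^ (s - 1 / q) * (N : ℝ) ^ (s - 1 / q) * w₂ := by ring
        _ ≤ _ := by
          gcongr
          · linarith
          · linarith
  refine (h1.trans (mul_le_mul_right (hD E f n) _)).trans (le_of_eq ?_)
  have e3 : (2 : ℝ) ^ (-(min s (1 - s)) * |(n : ℝ)|) = w₃ := by rw [hw₃, sub_zero]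
  rw [e3, ← ENNReal.ofReal_add hw₁0.le hw₂0.le, ← ENNReal.ofReal_mul (by positivity), ← mul_assoc,
    ← ENNReal.ofReal_mul (by positivity), mul_right_comm (ENNReal.ofReal _) (mixedNorm _ _ _),
    ← ENNReal.ofReal_mul (by positivity)]
  congr 2
  ring

/-- Upper bound for Haar projections on $F^s_{p,q}$, $1<p<q<\infty$,
$1/q<s<1/p$: $\|P_E f\|\le C(\#\mathrm{HF}(E))^{s-1/q}\|f\|$. -/
theorem haar_projection_upper_bound_pq
    (p q s : ℝ) (hp : 1 < p) (hpq : p < q)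
    (hs1 : 1/q < s) (hs2 : s < 1/p)
    (φ₀ : ℝ → ℂ) (hφsmooth : ContDiff ℝ (⊤ : ℕ∞) φ₀) (hφcpt : HasCompactSupport φ₀)
    (hφone : ∀ ξ : ℝ, |ξ| ≤ 4/3 → φ₀ ξ = 1)
    (hφzero : ∀ ξ : ℝ, 3/2 ≤ |ξ| → φ₀ ξ = 0) :
    ∃ C : ℝ, 0 < C ∧ ∀ (E : Finset (ℕ × ℤ)), E.Nonempty → ∀ f : SchwartzMap ℝ ℂ,
      FNorm φ₀ p q s (haarProj E f) ≤
        ENNReal.ofReal (C * ((HFset E).card : ℝ)^(s - 1/q)) * FNorm φ₀ p q s f := by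
  obtain ⟨Φ, hLP, hΦ1, hΦ⟩ := exists_lpKernel hφsmooth hφcpt hφone hφzero
  obtain ⟨C, hC0, hC⟩ := mixedNorm_diagonal_piece_le Φ hΦ hp hpq hs1 hs2
  have hp0 : 0 < p := by linarith
  have hq0 : 0 < q := by linarith
  have hs0 : 0 < s := lt_trans (by positivity) hs1
  have hs1' : s < 1 := hs2.trans (by rw [div_lt_one hp0]; exact hp)
  have hγ₁ : 0 < min (s - 1 / q) (1 / p - s) := lt_min (by linarith) (by linarith)
  have hγ₂ : 0 < min s (1 - s) := lt_min hs0 (by linarith)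
  have hg₁ := geomSum_pos hs0
  have hg₂ := geomSum_pos hγ₁
  have hg₃ := geomSum_pos hγ₂
  refine ⟨C * ((geomSum s + geomSum (min (s - 1 / q) (1 / p - s))) * geomSum (min s (1 - s))),
    by positivity, fun E hE f => ?_⟩
  obtain ⟨a, ha⟩ := hC E hE
  rw [FNorm_eq_mixedNorm hLP hq0, FNorm_eq_mixedNorm hLP hq0]
  refine (mixedNorm_mono hp0 hq0 (lpFamily_haarProj_le Φ hΦ1 f E s)).trans ?_
  refine (mixedNorm_diagonal_le hp.le (hp.trans hpq).le
    (a := fun j k l => lpFamily Φ s (haarPiece Φ E f j l) k) (fun j k l => measurable_lpFamily Φ s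
      (isDyadicStep_haarPiece Φ E f j l).measurable k)).trans ?_
  refine (ENNReal.tsum_le_tsum fun m => ENNReal.tsum_le_tsum fun n => ha f m n).trans ?_
  simp only [ENNReal.tsum_mul_left, ENNReal.tsum_mul_right, ENNReal.tsum_add]
  rw [tsum_geom_shift hs0, tsum_geom_shift hγ₁, tsum_geom_shift hγ₂,
    ← ENNReal.ofReal_add hg₁.le hg₂.le, ← ENNReal.ofReal_mul (by positivity), mul_right_comm,
    ← ENNReal.ofReal_mul (by positivity)]
  refine le_of_eq ?_
  congr 2
  ring
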